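/- arXiv:math/9605228 — 2 statements merged into one kernel-verified Lean document; each statement's English description precedes it below -/
import Mathlib

section
/- If F : ℝ² → ℝ² is a lift of a torus homeomorphism f homotopic to the identity (i.e. F commutes with all integer translations) and F has no fixed points, then there exists ε > 0 such that no periodic ε-chain for F exists. -/
open Filter Topology

/-- `F` commutes with all integer translations. -/
def IsTorusLift (F : ℝ × ℝ → ℝ × ℝ) : Prop :=
  ∀ (x : ℝ × ℝ) (m : ℤ × ℤ),
    F (x + ((m.1 : ℝ), (m.2 : ℝ))) = F x + ((m.1 : ℝ), (m.2 : ℝ))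

open Set Metric

/-- A ball contains the support of a homeomorphism moving its centre to a given point of it. -/
theorem exists_homeomorph_of_dist_lt {a b : ℂ} {ρ : ℝ} (h : dist b a < ρ) :
    ∃ φ : ℂ ≃ₜ ℂ, (∀ z ∉ ball a ρ, φ z = z) ∧ φ a = b := by
  have hρ : 0 < ρ := dist_nonneg.trans_lt h
  let f : ℂ → ℂ := fun z ↦ z + max 0 (1 - dist z a / ρ) • (b - a)
  let c : NNReal := ⟨dist b a / ρ, by positivity⟩
  have hf : ApproximatesLinearOn f
      ((ContinuousLinearEquiv.refl ℝ ℂ : ℂ ≃L[ℝ] ℂ) : ℂ →L[ℝ] ℂ) univ c := by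
    intro x _ y _
    have key : |max 0 (1 - dist x a / ρ) - max 0 (1 - dist y a / ρ)| ≤ dist x y / ρ := by
      refine (abs_max_sub_max_le_max _ _ _ _).trans ?_
      rw [sub_self, abs_zero, max_eq_right (abs_nonneg _)]
      have : 1 - dist x a / ρ - (1 - dist y a / ρ) = (dist y a - dist x a) / ρ := by ring
      rw [this, abs_div, abs_of_pos hρ]
      gcongr
      rw [dist_comm x y]
      exact abs_dist_sub_le y x a
    have : f x - f y - (x - y) =
        (max 0 (1 - dist x a / ρ) - max 0 (1 - dist y a / ρ)) • (b - a) := by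
      simp only [f, sub_smul]; ring
    simp only [ContinuousLinearEquiv.coe_coe, ContinuousLinearEquiv.refl_apply]
    rw [this, norm_smul, Real.norm_eq_abs, ← dist_eq_norm b a, ← dist_eq_norm x y]
    calc _ ≤ dist x y / ρ * dist b a := by gcongr
      _ = dist b a / ρ * dist x y := by ring
  have hc : Subsingleton ℂ ∨
      c < ‖((ContinuousLinearEquiv.refl ℝ ℂ).symm : ℂ →L[ℝ] ℂ)‖₊⁻¹ := by
    right
    have : ‖((ContinuousLinearEquiv.refl ℝ ℂ).symm : ℂ →L[ℝ] ℂ)‖₊ = 1 := by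
      ext; exact ContinuousLinearMap.norm_id
    rw [this, inv_one, ← NNReal.coe_lt_coe]
    exact (div_lt_one hρ).2 h
  refine ⟨hf.toHomeomorph f hc, fun z hz ↦ ?_, ?_⟩
  · change f z = z
    have : 1 - dist z a / ρ ≤ 0 := by
      rw [mem_ball, not_lt] at hz
      rw [sub_nonpos, one_le_div hρ]; exact hz
    simp [f, max_eq_left this]
  · change f a = b
    simp [f]

/-- Two points of a preconnected set `K` are exchanged by a homeomorphism supported in a given
neighbourhood of `K`. -/
theorem IsPreconnected.exists_homeomorph {K U : Set ℂ} (hK : IsPreconnected K) (hU : IsOpen U)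
    (hKU : K ⊆ U) {a b : ℂ} (ha : a ∈ K) (hb : b ∈ K) :
    ∃ φ : ℂ ≃ₜ ℂ, (∀ z ∉ U, φ z = z) ∧ φ a = b := by
  refine hK.induction₂ (fun a b ↦ ∃ φ : ℂ ≃ₜ ℂ, (∀ z ∉ U, φ z = z) ∧ φ a = b) ?_ ?_ ?_ ha hb
  · intro x hx
    obtain ⟨ρ, hρ, hball⟩ := Metric.isOpen_iff.1 hU x (hKU hx)
    filter_upwards [mem_nhdsWithin_of_mem_nhds (ball_mem_nhds x hρ)] with y hy
    obtain ⟨φ, h1, h2⟩ := exists_homeomorph_of_dist_lt (mem_ball.1 hy)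
    exact ⟨φ, fun z hz ↦ h1 z fun h ↦ hz (hball h), h2⟩
  · rintro x y z - - - ⟨φ, h1, h2⟩ ⟨ψ, h3, h4⟩
    exact ⟨φ.trans ψ, fun w hw ↦ by simp [h1 w hw, h3 w hw], by simp [h2, h4]⟩
  · rintro x y - - ⟨φ, h1, h2⟩
    exact ⟨φ.symm, fun w hw ↦ by rw [Homeomorph.symm_apply_eq, h1 w hw],
      by rw [Homeomorph.symm_apply_eq, h2]⟩

theorem Homeomorph.mem_of_forall_notMem {U : Set ℂ} {φ : ℂ ≃ₜ ℂ} (hφ : ∀ z ∉ U, φ z = z) {z : ℂ}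
    (hz : z ∈ U) : φ z ∈ U := by
  by_contra h
  rw [φ.injective (hφ _ h)] at h
  exact h hz

/-- Nonvanishing functions on simply connected spaces have continuous logarithms. -/
theorem exists_continuous_exp_eq {A : Type*} [TopologicalSpace A] [SimplyConnectedSpace A]
    [LocallyPathConnectedSpace A] {f : A → ℂ} (hf : Continuous f) (h0 : ∀ a, f a ≠ 0) :
    ∃ g : A → ℂ, Continuous g ∧ ∀ a, Complex.exp (g a) = f a := by
  obtain ⟨a₀⟩ : Nonempty A := inferInstance
  obtain ⟨F, ⟨-, hF⟩, -⟩ := Complex.isCoveringMap_exp.existsUnique_continuousMap_lifts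
    ⟨fun a ↦ ⟨f a, h0 a⟩, by fun_prop⟩ a₀ (Complex.log (f a₀))
    (Subtype.ext (Complex.exp_log (h0 a₀)))
  exact ⟨F, F.continuous, fun a ↦ congrArg Subtype.val (congrFun hF a)⟩

theorem IsPreconnected.eq_of_exp_eq_one {A : Type*} [TopologicalSpace A] {s : Set A}
    (hs : IsPreconnected s) {f : A → ℂ} (hf : ContinuousOn f s)
    (h1 : ∀ a ∈ s, Complex.exp (f a) = 1) {a b : A} (ha : a ∈ s) (hb : b ∈ s) : f a = f b := by
  have : IsDiscrete (Complex.exp ⁻¹' {1}) :=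
    isDiscrete_iff_discreteTopology.2
      (Complex.isCoveringMapOn_exp 1 (by simp)).discreteTopology_fiber
  exact hs.constant_of_mapsTo this hf h1 ha hb

/-- A fixed point free homeomorphism of the plane at bounded distance from the identity has no point
of period two. -/
theorem two_periodic_ne {h : ℂ ≃ₜ ℂ} {R : ℝ} (hR : ∀ z, dist (h z) z ≤ R) (hfix : ∀ z, h z ≠ z)
    (x : ℂ) : h (h x) ≠ x := by
  intro hx
  have hc : Continuous h := h.continuous
  let Q : ℂ × ℂ → ℂ := fun p ↦ (h (p.1 + Complex.exp p.2) - h p.1) / Complex.exp p.2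
  have hQ : Continuous Q :=
    Continuous.div (by fun_prop) (by fun_prop) fun p ↦ Complex.exp_ne_zero _
  have hQ0 : ∀ p, Q p ≠ 0 := fun p ↦
    div_ne_zero (sub_ne_zero.2 fun he ↦ by simpa using h.injective he) (Complex.exp_ne_zero _)
  obtain ⟨L, hL, hLQ⟩ := exists_continuous_exp_eq hQ hQ0
  obtain ⟨g, hg, hgV⟩ := exists_continuous_exp_eq (f := fun z ↦ h z - z) (by fun_prop)
    fun z ↦ sub_ne_zero.2 (hfix z)
  let σ : ℂ × ℂ → ℂ × ℂ := fun p ↦ (p.1 + Complex.exp p.2, p.2 + Real.pi * Complex.I)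
  have hσ : Continuous σ := by fun_prop
  have hQσ : ∀ p, Q (σ p) = Q p := fun p ↦ by
    simp only [Q, σ, Complex.exp_add, Complex.exp_pi_mul_I]
    rw [mul_neg_one, add_neg_cancel_right, div_neg, ← neg_div, neg_sub]
  -- far from the diagonal `Q` is close to `1`
  let S : Set (ℂ × ℂ) := {p | 2 * R < p.2.re}
  have hS : IsPreconnected S := by
    have : Convex ℝ ((Complex.reLm ∘ₗ LinearMap.snd ℝ ℂ ℂ) ⁻¹' Ioi (2 * R)) :=
      (convex_Ioi _).linear_preimage _
    exact this.isPreconnected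
  have hslit : ∀ p ∈ S, Q p ∈ Complex.slitPlane := fun p hp ↦ by
    have h1 : ‖Q p - 1‖ < 1 := by
      have : Q p - 1 = ((h (p.1 + Complex.exp p.2) - (p.1 + Complex.exp p.2)) -
          (h p.1 - p.1)) / Complex.exp p.2 := by
        simp only [Q]
        field_simp [Complex.exp_ne_zero]
        ring
      rw [this, norm_div, Complex.norm_exp, div_lt_one (Real.exp_pos _)]
      refine (norm_sub_le _ _).trans_lt ?_
      have h2 := hR (p.1 + Complex.exp p.2)
      have h3 := hR p.1
      rw [dist_eq_norm] at h2 h3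
      have h4 := Real.add_one_le_exp p.2.re
      have h5 : 2 * R < p.2.re := hp
      linarith
    simpa using Complex.mem_slitPlane_of_norm_lt_one h1
  have hLσ : ∀ p, L (σ p) = L p := by
    have hp₀ : ((0, (2 * R + 1 : ℝ)) : ℂ × ℂ) ∈ S := by
      change 2 * R < ((2 * R + 1 : ℝ) : ℂ).re
      rw [Complex.ofReal_re]; linarith
    have hσp₀ : ∀ p ∈ S, σ p ∈ S := fun p hp ↦ by
      change 2 * R < (p.2 + Real.pi * Complex.I).re
      have : 2 * R < p.2.re := hp
      simpa using this
    have hlog := hS.eq_of_exp_eq_one (f := fun p ↦ L p - Complex.log (Q p))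
      (hL.continuousOn.sub (hQ.continuousOn.clog hslit))
      (fun p _ ↦ by rw [Complex.exp_sub, hLQ, Complex.exp_log (hQ0 p), div_self (hQ0 p)])
      (hσp₀ _ hp₀) hp₀
    intro p
    have := isPreconnected_univ.eq_of_exp_eq_one (f := fun p ↦ L (σ p) - L p)
      (by fun_prop) (fun p _ ↦ by rw [Complex.exp_sub, hLQ, hLQ, hQσ, div_self (hQ0 p)])
      (mem_univ p) (mem_univ (0, ((2 * R + 1 : ℝ) : ℂ)))
    simp only [hQσ] at hlog
    rw [← sub_eq_zero, this, sub_eq_zero]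
    exact sub_left_injective hlog
  have hLper : ∀ a u, L (a, u + 2 * Real.pi * Complex.I) = L (a, u) := fun a u ↦ by
    have hσσ : σ (σ (a, u)) = (a, u + 2 * Real.pi * Complex.I) := by
      simp only [σ, Complex.exp_add, Complex.exp_pi_mul_I, Prod.mk.injEq]
      constructor <;> ring
    rw [← hσσ, hLσ, hLσ]
  have hLint : ∀ a u (m : ℤ), L (a, u + m * (2 * Real.pi * Complex.I)) = L (a, u) := by
    intro a u m
    induction m with
    | zero => simp
    | succ m ih => exact Eq.trans (by push_cast; congr 2; ring) ((hLper a _).trans ih)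
    | pred m ih => exact (hLper a _).symm.trans (Eq.trans (by push_cast; congr 2; ring) ih)
  have hconst := isPreconnected_univ.eq_of_exp_eq_one
    (f := fun z ↦ g (h z) - g z - L (z, g z)) (by fun_prop)
    (fun z _ ↦ by
      rw [Complex.exp_sub, Complex.exp_sub, hLQ, hgV, hgV]
      simp only [Q, hgV, add_sub_cancel]
      exact div_self (div_ne_zero (sub_ne_zero.2 (hfix _)) (sub_ne_zero.2 (hfix _))))
    (mem_univ x) (mem_univ (h x))
  have hexp : Complex.exp (g (h x)) = Complex.exp (g x + Real.pi * Complex.I) := by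
    rw [Complex.exp_add, Complex.exp_pi_mul_I, hgV, hgV, hx]; ring
  obtain ⟨m, hm⟩ := Complex.exp_eq_exp_iff_exists_int.1 hexp
  have hswap : L (h x, g (h x)) = L (x, g x) := by
    rw [hm, hLint, ← hLσ (x, g x)]
    simp only [σ, hgV, add_sub_cancel]
  simp only [hx, hswap] at hconst
  have h0 : g (h x) = g x := by
    have : 2 * (g (h x) - g x) = 0 := by linear_combination hconst
    simpa [sub_eq_zero] using this
  have h1 := hgV (h x)
  rw [h0, hgV, hx] at h1
  have : 2 * (h x - x) = 0 := by linear_combination h1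
  exact hfix x (by simpa [sub_eq_zero] using this)

/-- A compact set disjoint from its image has arbitrarily small bounded open neighbourhoods
with the same property. -/
theorem IsCompact.exists_isOpen_free {h : ℂ ≃ₜ ℂ} {K V : Set ℂ} (hK : IsCompact K)
    (hfree : ∀ z ∈ K, h z ∉ K) (hV : IsOpen V) (hKV : K ⊆ V) :
    ∃ U, IsOpen U ∧ Bornology.IsBounded U ∧ K ⊆ U ∧ U ⊆ V ∧ ∀ z ∈ U, h z ∉ U := by
  have hdisj : Disjoint K (h '' K) := by
    rw [Set.disjoint_right]
    rintro _ ⟨z, hz, rfl⟩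
    exact hfree z hz
  obtain ⟨A, B, hA, hB, hKA, hKB, hAB⟩ :=
    SeparatedNhds.of_isCompact_isCompact hK (hK.image h.continuous) hdisj
  obtain ⟨r, hr⟩ := hK.isBounded.subset_ball 0
  refine ⟨ball 0 r ∩ (V ∩ (A ∩ h ⁻¹' B)),
    isOpen_ball.inter (hV.inter (hA.inter (hB.preimage h.continuous))),
    isBounded_ball.subset inter_subset_left,
    fun z hz ↦ ⟨hr hz, hKV hz, hKA hz, hKB (mem_image_of_mem h hz)⟩, fun z hz ↦ hz.2.1, ?_⟩
  rintro z ⟨-, -, -, hzB⟩ ⟨-, -, hzA, -⟩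
  exact Set.disjoint_left.1 hAB hzA hzB

/-- The homeomorphisms of the plane at bounded distance from the identity. -/
def IsBoundedDisplacement (h : ℂ ≃ₜ ℂ) : Prop := ∃ R, ∀ z, dist (h z) z ≤ R

namespace IsBoundedDisplacement

theorem trans {h k : ℂ ≃ₜ ℂ} (hh : IsBoundedDisplacement h) (hk : IsBoundedDisplacement k) :
    IsBoundedDisplacement (h.trans k) := by
  obtain ⟨R, hR⟩ := hh
  obtain ⟨S, hS⟩ := hk
  exact ⟨S + R, fun z ↦ (dist_triangle _ (h z) _).trans (add_le_add (hS _) (hR _))⟩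

theorem symm {h : ℂ ≃ₜ ℂ} (hh : IsBoundedDisplacement h) : IsBoundedDisplacement h.symm := by
  obtain ⟨R, hR⟩ := hh
  refine ⟨R, fun z ↦ ?_⟩
  have := hR (h.symm z)
  rwa [h.apply_symm_apply, dist_comm] at this

theorem of_support {φ : ℂ ≃ₜ ℂ} {U : Set ℂ} (hU : Bornology.IsBounded U)
    (hφ : ∀ z ∉ U, φ z = z) : IsBoundedDisplacement φ := by
  obtain ⟨R, hR⟩ := Metric.isBounded_iff.1 hU
  refine ⟨max R 0, fun z ↦ ?_⟩
  by_cases hz : z ∈ U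
  · exact (hR (Homeomorph.mem_of_forall_notMem hφ hz) hz).trans (le_max_left _ _)
  · simp [hφ z hz]

end IsBoundedDisplacement

theorem Homeomorph.apply_apply_ne_of_free {h φ : ℂ ≃ₜ ℂ} {U : Set ℂ} (hfix : ∀ z, h z ≠ z)
    (hU : ∀ z ∈ U, h z ∉ U) (hφ : ∀ z ∉ U, φ z = z) (z : ℂ) : φ (h z) ≠ z := by
  intro hz
  by_cases hw : h z ∈ U
  · exact hU z (hz ▸ Homeomorph.mem_of_forall_notMem hφ hw) hw
  · exact hfix z ((hφ _ hw).symm.trans hz)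

/-- A fixed point free homeomorphism stays so after pushing points inside `U₁`, then inside the
image of `U₂`, when both sets are disjoint from their images and `h ∘ h` sends no point of `U₂`
to `U₁`. -/
theorem Homeomorph.push_push_ne {h φ ψ : ℂ ≃ₜ ℂ} {U₁ U₂ : Set ℂ} (hfix : ∀ z, h z ≠ z)
    (hU₁ : ∀ z ∈ U₁, h z ∉ U₁) (hU₂ : ∀ z ∈ U₂, h z ∉ U₂) (hU : ∀ z ∈ U₂, h (h z) ∉ U₁)
    (hφ : ∀ z ∉ U₁, φ z = z) (hψ : ∀ z ∉ U₂, ψ z = z) (z : ℂ) :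
    h (ψ (h.symm (φ (h z)))) ≠ z := by
  intro hz
  by_cases hv : h.symm (φ (h z)) ∈ U₂
  · have hu := Homeomorph.mem_of_forall_notMem hψ hv
    by_cases hw : h z ∈ U₁
    · exact hU _ hu (by rwa [hz])
    · rw [hφ _ hw, h.symm_apply_apply] at hv hu hz
      exact hU₂ _ hu (by rwa [hz])
  · rw [hψ _ hv, h.apply_symm_apply] at hz
    exact Homeomorph.apply_apply_ne_of_free hfix hU₁ hφ z hz

theorem eq_of_mem_segment_of_dist_eq {x y w : ℂ} {r : ℝ} (hr : 0 < r) (hy : dist y x ≤ r)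
    (hw : w ∈ segment ℝ x y) (hwr : dist w x = r) : w = y := by
  rw [segment_eq_image'] at hw
  obtain ⟨t, ⟨ht0, ht1⟩, rfl⟩ := hw
  rw [dist_eq_norm] at hy hwr
  simp only [add_sub_cancel_left, norm_smul, Real.norm_eq_abs, abs_of_nonneg ht0] at hwr
  have : t = 1 := by nlinarith
  simp [this]

theorem segment_subset_closedBall_of_dist_le {x y : ℂ} {r : ℝ} (hr : 0 < r) (hy : dist y x ≤ r) :
    segment ℝ x y ⊆ closedBall x r :=
  (convex_closedBall x r).segment_subset (mem_closedBall_self hr.le) hy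

theorem isCompact_segment (x y : ℂ) : IsCompact (segment ℝ x y) := by
  rw [segment_eq_image_lineMap]
  exact isCompact_Icc.image (by fun_prop)

/-- The largest open ball around `x` which is disjoint from its image. -/
theorem exists_critical_ball {h : ℂ ≃ₜ ℂ} (hfix : ∀ z, h z ≠ z) (x : ℂ) :
    ∃ r > 0, (∃ p, dist p x = r ∧ dist (h p) x = r) ∧
      ∀ q, dist q x ≤ r → dist (h q) x ≤ r → dist q x = r ∧ dist (h q) x = r := by
  let g : ℂ → ℝ := fun q ↦ max (dist q x) (dist (h q) x)
  have hg : Continuous g := by have := h.continuous; fun_prop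
  have hlim : Tendsto g (cocompact ℂ) atTop :=
    tendsto_atTop_mono (fun q ↦ le_max_left _ _) (tendsto_dist_right_cocompact_atTop x)
  obtain ⟨p, hp⟩ := hg.exists_forall_le hlim
  have hr : 0 < g p := by
    refine (le_max_of_le_left dist_nonneg).lt_of_ne fun h0 ↦ ?_
    have h1 : dist p x ≤ 0 := h0 ▸ le_max_left _ _
    have h2 : dist (h p) x ≤ 0 := h0 ▸ le_max_right _ _
    rw [dist_le_zero] at h1 h2
    exact hfix p (h2.trans h1.symm)
  have hfree : Disjoint (ball x (g p)) (h ⁻¹' ball x (g p)) := by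
    rw [Set.disjoint_left]
    intro q hq hhq
    exact (hp q).not_gt (max_lt hq hhq)
  have hop : IsOpen (h ⁻¹' ball x (g p)) := isOpen_ball.preimage h.continuous
  have h1 := hfree.closure_left hop
  have h2 := hfree.closure_right isOpen_ball
  rw [← h.preimage_closure, closure_ball x hr.ne'] at h2
  rw [closure_ball x hr.ne'] at h1
  have key : ∀ q, dist q x ≤ g p → dist (h q) x ≤ g p →
      dist q x = g p ∧ dist (h q) x = g p := fun q hq hhq ↦
    ⟨hq.antisymm (not_lt.1 fun hlt ↦ Set.disjoint_left.1 h2 hlt hhq),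
      hhq.antisymm (not_lt.1 fun hlt ↦ Set.disjoint_left.1 h1 hq hlt)⟩
  exact ⟨g p, hr, ⟨p, key p (le_max_left _ _) (le_max_right _ _)⟩, key⟩

/-- Brouwer's lemma: a fixed point free homeomorphism of the plane at bounded distance from the
identity has no periodic points. -/
theorem iterate_ne_self {n : ℕ} (hn : 1 ≤ n) {h : ℂ ≃ₜ ℂ} (hb : IsBoundedDisplacement h)
    (hfix : ∀ z, h z ≠ z) (x : ℂ) : h^[n] x ≠ x := by
  induction n using Nat.strong_induction_on generalizing h x with
  | _ n ih =>
  intro hx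
  obtain rfl | rfl | hn3 : n = 1 ∨ n = 2 ∨ 3 ≤ n := by omega
  · exact hfix x hx
  · obtain ⟨R, hR⟩ := hb
    exact two_periodic_ne hR hfix x hx
  obtain ⟨r, hr, ⟨p, hp, hy⟩, hcrit⟩ := exists_critical_ball hfix x
  by_cases hex : ∃ j, (1 ≤ j ∧ j < n) ∧ dist (h^[j] x) x ≤ r
  · -- close up the orbit at its first return to the ball
    classical
    obtain ⟨⟨hj1, hjn⟩, hjr⟩ := Nat.find_spec hex
    have hjmin := fun i ↦ Nat.find_min (m := i) hex
    set j := Nat.find hex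
    have hK := segment_subset_closedBall_of_dist_le hr hjr
    let T : Set ℂ := (fun i ↦ h^[i] x) '' Ico 1 j
    have hT : IsClosed T := ((finite_Ico 1 j).image _).isClosed
    obtain ⟨U, hUo, hUb, hKU, hUV, hU⟩ := (isCompact_segment x (h^[j] x)).exists_isOpen_free (h := h)
      (fun z hz hz' ↦ by
        obtain ⟨h1, h2⟩ := hcrit z (hK hz) (hK hz')
        exact hfix z ((eq_of_mem_segment_of_dist_eq hr hjr hz' h2).trans
          (eq_of_mem_segment_of_dist_eq hr hjr hz h1).symm))
      hT.isOpen_compl (by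
        rintro z hz ⟨i, ⟨hi1, hij⟩, rfl⟩
        exact hjmin i hij ⟨⟨hi1, hij.trans hjn⟩, hK hz⟩)
    obtain ⟨φ, hφ, hφj⟩ := (convex_segment x (h^[j] x)).isPreconnected.exists_homeomorph hUo hKU
      (right_mem_segment ℝ x (h^[j] x)) (left_mem_segment ℝ x (h^[j] x))
    have hit : ∀ i < j, (h.trans φ)^[i] x = h^[i] x := by
      intro i
      induction i with
      | zero => intro _; rfl
      | succ i ihi =>
        intro hi
        rw [Function.iterate_succ_apply', ihi (by omega), Homeomorph.trans_apply,
          ← Function.iterate_succ_apply' h]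
        exact hφ _ fun hmem ↦ hUV hmem ⟨i + 1, ⟨by omega, hi⟩, rfl⟩
    refine ih j hjn hj1 (hb.trans (.of_support hUb hφ))
      (Homeomorph.apply_apply_ne_of_free hfix hU hφ) x ?_
    obtain ⟨k, hk⟩ : ∃ k, j = k + 1 := ⟨j - 1, by omega⟩
    rw [hk, Function.iterate_succ_apply'] at hφj
    rw [hk, Function.iterate_succ_apply', hit k (by omega), Homeomorph.trans_apply, hφj]
  push Not at hex
  have hK₁ := segment_subset_closedBall_of_dist_le hr hy.le
  have hK₂ := segment_subset_closedBall_of_dist_le hr hp.le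
  by_cases hret : ∃ q ∈ segment ℝ x p, h (h q) ∈ segment ℝ x (h p)
  · -- create a point of period two
    obtain ⟨q, hq, hhq⟩ := hret
    have hqr : dist q x ≤ r := hK₂ hq
    have hhqr : dist (h (h q)) x ≤ r := hK₁ hhq
    have hKc : segment ℝ x (h (h q)) ∪ segment ℝ x q ⊆ closedBall x r :=
      union_subset (segment_subset_closedBall_of_dist_le hr hhqr)
        (segment_subset_closedBall_of_dist_le hr hqr)
    have hsph : ∀ z ∈ segment ℝ x (h (h q)) ∪ segment ℝ x q, dist z x = r →
        z = h (h q) ∧ z = h p ∨ z = q ∧ z = p := by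
      rintro z (hz | hz) hzr
      · obtain rfl := eq_of_mem_segment_of_dist_eq hr hhqr hz hzr
        exact .inl ⟨rfl, eq_of_mem_segment_of_dist_eq hr hy.le hhq hzr⟩
      · obtain rfl := eq_of_mem_segment_of_dist_eq hr hqr hz hzr
        exact .inr ⟨rfl, eq_of_mem_segment_of_dist_eq hr hp.le hq hzr⟩
    obtain ⟨U, hUo, hUb, hKU, -, hU⟩ :=
      ((isCompact_segment x (h (h q))).union (isCompact_segment x q)).exists_isOpen_free (h := h)
      (fun z hz hz' ↦ by
        obtain ⟨h1, h2⟩ := hcrit z (hKc hz) (hKc hz')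
        rcases hsph z hz h1 with ⟨a1, a2⟩ | ⟨a1, a2⟩ <;>
          rcases hsph _ hz' h2 with ⟨b1, b2⟩ | ⟨b1, b2⟩
        · exact hfix z (b1.trans a1.symm)
        · have : q = p := b1.symm.trans b2
          subst this
          exact hfix (h q) (a1.symm.trans a2)
        · have : q = p := a1.symm.trans a2
          subst this
          exact hfix (h q) (b1.symm.trans b2)
        · exact hfix z (b1.trans a1.symm))
      isOpen_univ (subset_univ _)
    have hpre : IsPreconnected (segment ℝ x (h (h q)) ∪ segment ℝ x q) :=
      (convex_segment x (h (h q))).isPreconnected.union x (left_mem_segment ℝ _ _)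
        (left_mem_segment ℝ _ _) (convex_segment x q).isPreconnected
    obtain ⟨φ, hφ, hφq⟩ := hpre.exists_homeomorph hUo hKU
      (.inl (right_mem_segment ℝ x (h (h q)))) (.inr (right_mem_segment ℝ x q))
    obtain ⟨R, hR⟩ := hb.trans (.of_support hUb hφ)
    refine two_periodic_ne hR (Homeomorph.apply_apply_ne_of_free hfix hU hφ) q ?_
    rw [Homeomorph.trans_apply, Homeomorph.trans_apply,
      hφ _ (hU q (hKU (.inr (right_mem_segment ℝ x q)))), hφq]
  -- skip one step of the orbit
  push Not at hret
  let T : Set ℂ := (fun i ↦ h^[i] x) '' Ico 1 n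
  have hT : IsClosed T := ((finite_Ico 1 n).image _).isClosed
  have hTball : closedBall x r ⊆ Tᶜ := by
    rintro _ hz ⟨i, hi, rfl⟩
    exact (hex i hi).not_ge hz
  obtain ⟨A, B, hA, hB, hKA, hKB, hAB⟩ := SeparatedNhds.of_isCompact_isCompact
    (isCompact_segment x (h p)) ((isCompact_segment x p).image (h.continuous.comp h.continuous))
    (by
      rw [Set.disjoint_right]
      rintro _ ⟨q, hq, rfl⟩
      exact hret q hq)
  obtain ⟨U₁, hUo₁, hUb₁, hKU₁, hUV₁, hU₁⟩ := (isCompact_segment x (h p)).exists_isOpen_free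
    (h := h) (fun z hz hz' ↦ by
      obtain ⟨h1, h2⟩ := hcrit z (hK₁ hz) (hK₁ hz')
      exact hfix z ((eq_of_mem_segment_of_dist_eq hr hy.le hz' h2).trans
        (eq_of_mem_segment_of_dist_eq hr hy.le hz h1).symm))
    (hT.isOpen_compl.inter hA) (subset_inter (hK₁.trans hTball) hKA)
  obtain ⟨U₂, hUo₂, hUb₂, hKU₂, hUV₂, hU₂⟩ := (isCompact_segment x p).exists_isOpen_free
    (h := h) (fun z hz hz' ↦ by
      obtain ⟨h1, h2⟩ := hcrit z (hK₂ hz) (hK₂ hz')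
      exact hfix z ((eq_of_mem_segment_of_dist_eq hr hp.le hz' h2).trans
        (eq_of_mem_segment_of_dist_eq hr hp.le hz h1).symm))
    (hT.isOpen_compl.inter (hB.preimage (h.continuous.comp h.continuous)))
    (subset_inter (hK₂.trans hTball) fun z hz ↦ hKB (mem_image_of_mem _ hz))
  obtain ⟨φ, hφ, hφx⟩ := (convex_segment x (h p)).isPreconnected.exists_homeomorph hUo₁ hKU₁
    (left_mem_segment ℝ x (h p)) (right_mem_segment ℝ x (h p))
  obtain ⟨ψ, hψ, hψp⟩ := (convex_segment x p).isPreconnected.exists_homeomorph hUo₂ hKU₂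
    (right_mem_segment ℝ x p) (left_mem_segment ℝ x p)
  let g : ℂ ≃ₜ ℂ := (h.trans φ).trans ((h.symm.trans ψ).trans h)
  have hgb : IsBoundedDisplacement g :=
    (hb.trans (.of_support hUb₁ hφ)).trans ((hb.symm.trans (.of_support hUb₂ hψ)).trans hb)
  have hgapply : ∀ z, g z = h (ψ (h.symm (φ (h z)))) := fun _ ↦ rfl
  have hit : ∀ k, k + 1 < n → g^[k] (h x) = h^[k + 1] x := by
    intro k
    induction k with
    | zero => intro _; rfl
    | succ k ihk =>
      intro hk
      have h1 : φ (h^[k + 1 + 1] x) = h^[k + 1 + 1] x :=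
        hφ _ fun hmem ↦ (hUV₁ hmem).1 ⟨k + 1 + 1, ⟨by omega, hk⟩, rfl⟩
      have h2 : ψ (h^[k + 1] x) = h^[k + 1] x :=
        hψ _ fun hmem ↦ (hUV₂ hmem).1 ⟨k + 1, ⟨by omega, by omega⟩, rfl⟩
      rw [Function.iterate_succ_apply' h (k + 1)] at h1 ⊢
      rw [Function.iterate_succ_apply', ihk (by omega), hgapply, h1, h.symm_apply_apply, h2]
  refine ih (n - 1) (by omega) (by omega) hgb
    (Homeomorph.push_push_ne hfix hU₁ hU₂ (fun z hz hz' ↦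
      Set.disjoint_left.1 hAB (hUV₁ hz').2 (hUV₂ hz).2) hφ hψ) (h x) ?_
  obtain ⟨k, rfl⟩ : ∃ k, n = k + 2 := ⟨n - 2, by omega⟩
  rw [show k + 2 - 1 = k + 1 by omega, Function.iterate_succ_apply', hit k (by omega), hgapply,
    ← Function.iterate_succ_apply' h, hx, hφx, h.symm_apply_apply, hψp]

/-- Homeomorphisms with pairwise disjoint supports have a common extension. -/
theorem exists_homeomorph_of_disjoint_supports (φ : ℕ → ℂ ≃ₜ ℂ) (U : ℕ → Set ℂ) (n : ℕ)
    (hφ : ∀ i < n, ∀ z ∉ U i, φ i z = z)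
    (hU : ∀ i < n, ∀ j < n, i ≠ j → Disjoint (U i) (U j)) :
    ∃ Φ : ℂ ≃ₜ ℂ, (∀ i < n, ∀ z ∈ U i, Φ z = φ i z) ∧ ∀ z, (∀ i < n, z ∉ U i) → Φ z = z := by
  induction n with
  | zero => exact ⟨Homeomorph.refl ℂ, by simp, by simp⟩
  | succ n ih =>
    obtain ⟨Φ, h1, h2⟩ := ih (fun i hi ↦ hφ i (by omega))
      (fun i hi j hj ↦ hU i (by omega) j (by omega))
    refine ⟨Φ.trans (φ n), fun i hi z hz ↦ ?_, fun z hz ↦ ?_⟩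
    · rw [Homeomorph.trans_apply]
      obtain hin | rfl := Nat.lt_succ_iff_lt_or_eq.1 hi
      · rw [h1 i hin z hz]
        exact hφ n (by omega) _ (Set.disjoint_left.1 (hU i hi n (by omega) hin.ne)
          (Homeomorph.mem_of_forall_notMem (hφ i hi) hz))
      · rw [h2 z fun j hj ↦ Set.disjoint_right.1 (hU j (by omega) i hi hj.ne) hz]
    · rw [Homeomorph.trans_apply, h2 z fun i hi ↦ hz i (by omega), hφ n (by omega) z
        (hz n (by omega))]

theorem dist_lt_or_dist_lt_of_segments_meet {a b c d : ℂ} {ε : ℝ} (hab : dist a b < ε)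
    (hcd : dist c d < ε) (h : ¬ Disjoint (segment ℝ a b) (segment ℝ c d)) :
    dist a d < ε ∨ dist c b < ε := by
  obtain ⟨w, hw₁, hw₂⟩ := Set.not_disjoint_iff.1 h
  have h1 := dist_add_dist_of_mem_segment hw₁
  have h2 := dist_add_dist_of_mem_segment hw₂
  have h3 := dist_triangle a w d
  have h4 := dist_triangle c w b
  by_contra! h5
  linarith [h5.1, h5.2]

/-- A homeomorphism of the plane at bounded distance from the identity which moves all points by at
least `δ` has no periodic chain with jumps less than `δ / 2`. -/
theorem no_periodic_chain {h : ℂ ≃ₜ ℂ} (hb : IsBoundedDisplacement h) {δ : ℝ} (hδ : 0 < δ)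
    (hd : ∀ z, δ ≤ dist (h z) z) {n : ℕ} (hn : 1 ≤ n) (x : ℕ → ℂ) (hx : x n = x 0) :
    ¬ ∀ i < n, dist (h (x i)) (x (i + 1)) < δ / 2 := by
  induction n using Nat.strong_induction_on generalizing x with
  | _ n ih =>
  intro hchain
  -- in a shortest chain no jump can be redirected
  have hshort : ∀ i j, i < j → j < n →
      ¬ (dist (h (x i)) (x (j + 1)) < δ / 2 ∨ dist (h (x j)) (x (i + 1)) < δ / 2) := by
    rintro i j hij hj (hlt | hlt)
    · refine ih (n - (j - i)) (by omega) (by omega)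
        (fun k ↦ if k ≤ i then x k else x (k + (j - i))) ?_ fun k hk ↦ ?_
      · simp only [zero_le, if_true]
        rw [if_neg (by omega), ← hx]
        congr 1; omega
      · obtain hki | rfl | hki := lt_trichotomy k i
        · simpa [hki.le, Nat.succ_le_of_lt hki] using hchain k (by omega)
        · simpa [show k + 1 + (j - k) = j + 1 by omega] using hlt
        · simpa [show ¬ k ≤ i by omega, show ¬ k + 1 ≤ i by omega,
            show k + 1 + (j - i) = k + (j - i) + 1 by omega] using
            hchain (k + (j - i)) (by omega)
    · refine ih (j - i) (by omega) (by omega)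
        (fun k ↦ if k < j - i then x (i + 1 + k) else x (i + 1)) ?_ fun k hk ↦ ?_
      · simp [hij]
      · obtain hkj | hkj : k + 1 < j - i ∨ k + 1 = j - i := by omega
        · simpa [hk, hkj, ← add_assoc] using hchain (i + 1 + k) (by omega)
        · simpa [hk, hkj, show i + 1 + k = j by omega] using hlt
  have hdisj : ∀ i < n, ∀ j < n, i ≠ j →
      Disjoint (segment ℝ (h (x i)) (x (i + 1))) (segment ℝ (h (x j)) (x (j + 1))) := by
    intro i hi j hj hij
    by_contra hmeet
    have := dist_lt_or_dist_lt_of_segments_meet (hchain i hi) (hchain j hj) hmeet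
    obtain hlt | hlt := hij.lt_or_gt
    · exact hshort i j hlt hj this
    · exact hshort j i hlt hi this.symm
  obtain ⟨ρ, hρ0, hρ⟩ : ∃ ρ > 0, ∀ i ∈ Finset.range n, ∀ j ∈ Finset.range n, i ≠ j →
      Disjoint (thickening ρ (segment ℝ (h (x i)) (x (i + 1))))
        (thickening ρ (segment ℝ (h (x j)) (x (j + 1)))) := by
    have hev : ∀ᶠ ρ : ℝ in 𝓝[>] 0, ∀ i ∈ Finset.range n, ∀ j ∈ Finset.range n, i ≠ j →
        Disjoint (thickening ρ (segment ℝ (h (x i)) (x (i + 1))))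
          (thickening ρ (segment ℝ (h (x j)) (x (j + 1)))) := by
      simp only [Finset.eventually_all, eventually_imp_distrib_left]
      intro i hi j hj hij
      rw [Finset.mem_range] at hi hj
      obtain ⟨ρ, hρ0, hρ⟩ := (hdisj i hi j hj hij).exists_thickenings (isCompact_segment _ _)
        (isCompact_segment _ _).isClosed
      filter_upwards [Ioo_mem_nhdsGT hρ0] with s hs
      exact hρ.mono (thickening_mono hs.2.le _) (thickening_mono hs.2.le _)
    obtain ⟨ρ, h1, h2⟩ := (hev.and self_mem_nhdsWithin).exists
    exact ⟨ρ, h2, h1⟩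
  let U : ℕ → Set ℂ := fun i ↦
    thickening ρ (segment ℝ (h (x i)) (x (i + 1))) ∩ ball (x (i + 1)) (δ / 2)
  have hSU : ∀ i < n, segment ℝ (h (x i)) (x (i + 1)) ⊆ U i := fun i hi ↦
    subset_inter (self_subset_thickening hρ0 _)
      ((convex_ball _ _).segment_subset (hchain i hi) (mem_ball_self (by positivity)))
  have hpush : ∀ i, ∃ φ : ℂ ≃ₜ ℂ, i < n → (∀ z ∉ U i, φ z = z) ∧ φ (h (x i)) = x (i + 1) := by
    intro i
    by_cases hi : i < n
    · obtain ⟨φ, hφ⟩ := (convex_segment (h (x i)) (x (i + 1))).isPreconnected.exists_homeomorph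
        (isOpen_thickening.inter isOpen_ball) (hSU i hi) (left_mem_segment ℝ _ _)
        (right_mem_segment ℝ _ _)
      exact ⟨φ, fun _ ↦ hφ⟩
    · exact ⟨Homeomorph.refl ℂ, fun h ↦ absurd h hi⟩
  choose φ hφ using hpush
  obtain ⟨Φ, hΦ, hΦ'⟩ := exists_homeomorph_of_disjoint_supports φ U n (fun i hi ↦ (hφ i hi).1)
    fun i hi j hj hij ↦ (hρ i (Finset.mem_range.2 hi) j (Finset.mem_range.2 hj) hij).mono
      inter_subset_left inter_subset_left
  have hΦd : ∀ z, dist (Φ z) z < δ := by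
    intro z
    by_cases hz : ∃ i < n, z ∈ U i
    · obtain ⟨i, hi, hzi⟩ := hz
      have h1 : dist z (x (i + 1)) < δ / 2 := hzi.2
      have h2 : dist (φ i z) (x (i + 1)) < δ / 2 :=
        (Homeomorph.mem_of_forall_notMem (hφ i hi).1 hzi).2
      rw [hΦ i hi z hzi]
      linarith [dist_triangle_right (φ i z) z (x (i + 1))]
    · push Not at hz
      rw [hΦ' z hz, dist_self]
      exact hδ
  have hit : ∀ k ≤ n, (h.trans Φ)^[k] (x 0) = x k := by
    intro k
    induction k with
    | zero => intro _; rfl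
    | succ k ihk =>
      intro hk
      rw [Function.iterate_succ_apply', ihk (by omega), Homeomorph.trans_apply,
        hΦ k hk _ (hSU k hk (left_mem_segment ℝ _ _)), (hφ k hk).2]
  refine iterate_ne_self hn (hb.trans ⟨δ, fun z ↦ (hΦd z).le⟩) (fun z hz ↦ ?_) (x 0)
    ((hit n le_rfl).trans hx)
  have := hΦd (h z)
  rw [← Homeomorph.trans_apply, hz, dist_comm] at this
  exact (hd z).not_gt this

theorem IsTorusLift.exists_displacement_bounds {F : (ℝ × ℝ) ≃ₜ (ℝ × ℝ)} (hlift : IsTorusLift F)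
    (hfix : ∀ x, F x ≠ x) :
    ∃ δ > 0, ∃ R, ∀ x, δ ≤ dist (F x) x ∧ dist (F x) x ≤ R := by
  have hcont : ContinuousOn (fun x ↦ dist (F x) x) (Icc (0 : ℝ × ℝ) 1) := by
    have := F.continuous
    fun_prop
  have hne : (Icc (0 : ℝ × ℝ) 1).Nonempty := ⟨0, le_rfl, zero_le_one⟩
  obtain ⟨a, -, ha⟩ := isCompact_Icc.exists_isMinOn hne hcont
  obtain ⟨b, -, hb⟩ := isCompact_Icc.exists_isMaxOn hne hcont
  refine ⟨dist (F a) a, dist_pos.2 (hfix a), dist (F b) b, fun x ↦ ?_⟩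
  let y : ℝ × ℝ := (Int.fract x.1, Int.fract x.2)
  have hy : y ∈ Icc (0 : ℝ × ℝ) 1 :=
    ⟨⟨Int.fract_nonneg _, Int.fract_nonneg _⟩, ⟨(Int.fract_lt_one _).le, (Int.fract_lt_one _).le⟩⟩
  have hxy : x = y + ((⌊x.1⌋ : ℝ), (⌊x.2⌋ : ℝ)) := by
    ext <;> simp [y]
  have hd : dist (F x) x = dist (F y) y := by
    rw [hxy, hlift y (⌊x.1⌋, ⌊x.2⌋), dist_add_right]
  rw [hd]
  exact ⟨ha hy, hb hy⟩

theorem no_periodic_eps_chain_of_fixed_point_free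
    (F : (ℝ × ℝ) ≃ₜ (ℝ × ℝ)) (hlift : IsTorusLift F)
    (hfix : ∀ x : ℝ × ℝ, F x ≠ x) :
    ∃ ε > (0 : ℝ), ¬ ∃ (n : ℕ) (x : ℕ → ℝ × ℝ),
      2 ≤ n ∧ x 0 = x (n - 1) ∧
      ∀ i < n - 1, dist (F (x i)) (x (i + 1)) < ε := by
  obtain ⟨δ, hδ, R, hFδ⟩ := hlift.exists_displacement_bounds hfix
  let e : (ℝ × ℝ) ≃ₜ ℂ := Complex.equivRealProdCLM.symm.toHomeomorph
  have he : ∀ a b, dist a b ≤ dist (e a) (e b) ∧ dist (e a) (e b) ≤ 2 * dist a b := by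
    intro a b
    have hre : (e a - e b).re = a.1 - b.1 := by simp [e]
    have him : (e a - e b).im = a.2 - b.2 := by simp [e]
    rw [dist_eq_norm (e a), Prod.dist_eq, Real.dist_eq, Real.dist_eq, ← hre, ← him]
    have h1 := Complex.abs_re_le_norm (e a - e b)
    have h2 := Complex.abs_im_le_norm (e a - e b)
    have h3 := Complex.norm_le_abs_re_add_abs_im (e a - e b)
    have h4 := le_max_left |(e a - e b).re| |(e a - e b).im|
    have h5 := le_max_right |(e a - e b).re| |(e a - e b).im|
    exact ⟨max_le h1 h2, by linarith⟩
  let h : ℂ ≃ₜ ℂ := (e.symm.trans F).trans e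
  have hdist : ∀ z, dist (h z) z = dist (e (F (e.symm z))) (e (e.symm z)) := fun z ↦ by
    rw [e.apply_symm_apply]; rfl
  have hb : IsBoundedDisplacement h := ⟨2 * R, fun z ↦ by
    rw [hdist]
    linarith [(he (F (e.symm z)) (e.symm z)).2, (hFδ (e.symm z)).2]⟩
  refine ⟨δ / 4, by positivity, ?_⟩
  rintro ⟨n, x, hn, hx, hchain⟩
  refine no_periodic_chain hb hδ (fun z ↦ ?_) (n := n - 1) (by omega) (fun i ↦ e (x i))
    (congrArg e hx.symm) fun i hi ↦ ?_
  · rw [hdist]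
    exact (hFδ _).1.trans (he _ _).1
  · have : h (e (x i)) = e (F (x i)) := congrArg (fun p ↦ e (F p)) (e.symm_apply_apply (x i))
    rw [this]
    linarith [(he (F (x i)) (x (i + 1))).2, hchain i hi]
end

section
/- Suppose f : 𝕋² → 𝕋² is an area-preserving homeomorphism homotopic to the identity with lift F : ℝ² → ℝ², and suppose the rotation set 𝓡(F) is a line segment (possibly degenerate). If ν = (p/q, r/q) ∈ 𝓡(F) with p, q, r integers, q ≥ 1, then there exists z ∈ ℝ² such that π(z) is a periodic point of f and F^q(z) = z + (p, r). -/
open Filter Topology MeasureTheory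

abbrev Torus2 := AddCircle (1 : ℝ) × AddCircle (1 : ℝ)

noncomputable def torusProj (x : ℝ × ℝ) : Torus2 := ((x.1 : AddCircle (1 : ℝ)), (x.2 : AddCircle (1 : ℝ)))

def RotSet (F : ℝ × ℝ → ℝ × ℝ) : Set (ℝ × ℝ) :=
  {v | ∃ (x : ℕ → ℝ × ℝ) (n : ℕ → ℕ), Tendsto n atTop atTop ∧
    Tendsto (fun i => (n i : ℝ)⁻¹ • (F^[n i] (x i) - x i)) atTop (nhds v)}

theorem exists_continuousOn_log {E : Type*} [NormedAddCommGroup E] [NormedSpace ℝ E] {T : Set E}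
    (hT : Convex ℝ T) {φ : E → ℂ} (hφ : ContinuousOn φ T) (h0 : ∀ x ∈ T, φ x ≠ 0) :
    ∃ Φ : E → ℂ, ContinuousOn Φ T ∧ ∀ x ∈ T, Complex.exp (Φ x) = φ x := by
  classical
  rcases T.eq_empty_or_nonempty with rfl | ⟨p, hp⟩
  · exact ⟨0, by simp, by simp⟩
  have hmem : ∀ ta : unitInterval × T, p + (ta.1 : ℝ) • ((ta.2 : E) - p) ∈ T := fun ta =>
    hT.add_smul_sub_mem hp ta.2.2 ⟨ta.1.2.1, ta.1.2.2⟩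
  let H : C(unitInterval × T, {z : ℂ // z ≠ 0}) :=
    ⟨fun ta => ⟨φ (p + (ta.1 : ℝ) • ((ta.2 : E) - p)), h0 _ (hmem ta)⟩, by
      refine Continuous.subtype_mk ?_ _
      exact hφ.comp_continuous (by fun_prop) hmem⟩
  let f : C(T, ℂ) := ⟨fun _ => Complex.log (φ p), continuous_const⟩
  have H0 : ∀ a, H (0, a) = (⟨Complex.exp (f a), Complex.exp_ne_zero _⟩ : {z : ℂ // z ≠ 0}) := by
    intro a
    apply Subtype.ext
    simp [H, f, Complex.exp_log (h0 p hp)]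
  let L := Complex.isCoveringMap_exp.liftHomotopy H f H0
  have hL := Complex.isCoveringMap_exp.liftHomotopy_lifts H f H0
  refine ⟨fun x => if hx : x ∈ T then L (1, ⟨x, hx⟩) else 0, ?_, ?_⟩
  · rw [continuousOn_iff_continuous_domRestrict]
    have : Continuous fun a : T => L (1, a) := by fun_prop
    convert! this using 2 with a
    simp
  · intro x hx
    have := congrArg Subtype.val (congr_fun hL (1, ⟨x, hx⟩))
    simpa [hx, H, L] using this

theorem exists_int_of_exp_eq {X : Type*} [TopologicalSpace X] {T : Set X}
    (hT : IsPreconnected T) {Φ Ψ : X → ℂ} (hΦ : ContinuousOn Φ T) (hΨ : ContinuousOn Ψ T)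
    (h : ∀ x ∈ T, Complex.exp (Φ x) = Complex.exp (Ψ x)) :
    ∃ k : ℤ, ∀ x ∈ T, Φ x = Ψ x + 2 * k * (Real.pi * Complex.I) := by
  rcases T.eq_empty_or_nonempty with rfl | ⟨p, hp⟩
  · exact ⟨0, by simp⟩
  have key : ∀ x ∈ T, ∃ k : ℤ, Φ x = Ψ x + k * (2 * Real.pi * Complex.I) := fun x hx =>
    Complex.exp_eq_exp_iff_exists_int.1 (h x hx)
  choose! k hk using key
  have hkr : ∀ x ∈ T, ((k x : ℤ) : ℝ) = ((Φ x - Ψ x) / (2 * Real.pi * Complex.I)).re := by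
    intro x hx
    rw [hk x hx, add_sub_cancel_left, mul_div_assoc, div_self Complex.two_pi_I_ne_zero]
    simp
  have hc : ContinuousOn (fun x => ((k x : ℤ) : ℝ)) T := by
    refine ContinuousOn.congr ?_ hkr
    exact Complex.continuous_re.comp_continuousOn ((hΦ.sub hΨ).div_const _)
  have hc' : ContinuousOn k T := by
    have := Int.isClosedEmbedding_coe_real.isEmbedding.isInducing
    exact (this.continuousOn_iff).2 hc
  refine ⟨k p, fun x hx => ?_⟩
  have := hT.constant hc' hx hp
  rw [hk x hx, this]; ring

theorem exists_odd_of_exp_eq_neg {X : Type*} [TopologicalSpace X] {T : Set X}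
    (hT : IsPreconnected T) {Φ Ψ : X → ℂ} (hΦ : ContinuousOn Φ T) (hΨ : ContinuousOn Ψ T)
    (h : ∀ x ∈ T, Complex.exp (Φ x) = -Complex.exp (Ψ x)) :
    ∃ m : ℤ, Odd m ∧ ∀ x ∈ T, Φ x = Ψ x + m * (Real.pi * Complex.I) := by
  obtain ⟨k, hk⟩ := exists_int_of_exp_eq hT hΦ (Ψ := fun x => Ψ x + Real.pi * Complex.I)
    (hΨ.add continuousOn_const) (fun x hx => by rw [h x hx, Complex.exp_add, Complex.exp_pi_mul_I]; ring)
  refine ⟨2 * k + 1, ⟨k, rfl⟩, fun x hx => ?_⟩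
  rw [hk x hx]; push_cast; ring

/-- Logarithms of the chords `h y - h x`, written in terms of a logarithm of `y - x`, turn by
`2πi` whenever the logarithm of `y - x` does. -/
theorem chord_log_add_two_pi {h : ℂ ≃ₜ ℂ} {M : ℝ} (hM : ∀ x, ‖h x - x‖ ≤ M)
    {Λ : ℂ × ℂ → ℂ} (hΛ : Continuous Λ)
    (hexp : ∀ p, Complex.exp (Λ p) = h (p.1 + Complex.exp p.2) - h p.1) (x w : ℂ) :
    Λ (x, w + 2 * (Real.pi * Complex.I)) = Λ (x, w) + 2 * (Real.pi * Complex.I) := by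
  have hper : ∀ w : ℂ, Complex.exp (w + 2 * (Real.pi * Complex.I)) = Complex.exp w := by
    intro w
    have := Complex.exp_periodic w
    rwa [mul_assoc] at this
  obtain ⟨k, hk⟩ := exists_int_of_exp_eq (T := (Set.univ : Set (ℂ × ℂ))) isPreconnected_univ
    (Φ := fun p => Λ (p.1, p.2 + 2 * (Real.pi * Complex.I))) (Ψ := Λ)
    (by fun_prop) (by fun_prop) (by
      intro p _
      rw [hexp, hexp]
      simp only [hper])
  have hM0 : 0 ≤ M := (norm_nonneg _).trans (hM 0)
  obtain ⟨R, hR⟩ : ∃ R : ℝ, 2 * M < Real.exp R := by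
    exact ⟨2 * M, by linarith [Real.add_one_le_exp (2 * M)]⟩
  -- along the segment `R + i s` the chord is a small perturbation of `exp (R + i s)`
  let η : ℝ → ℂ := fun s => (h (Complex.exp (R + s * Complex.I)) - h 0) / Complex.exp (R + s * Complex.I)
  have hη : ∀ s, η s ∈ Complex.slitPlane := by
    intro s
    suffices hlt : ‖η s - 1‖ < 1 by
      have := Complex.mem_slitPlane_of_norm_lt_one hlt
      rwa [add_sub_cancel] at this
    have e0 : Complex.exp (R + s * Complex.I) ≠ 0 := Complex.exp_ne_zero _
    have : η s - 1 = ((h (Complex.exp (R + s * Complex.I)) - Complex.exp (R + s * Complex.I)) - (h 0 - 0))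
        / Complex.exp (R + s * Complex.I) := by
      simp only [η]; field_simp; ring
    rw [this, norm_div, Complex.norm_exp, div_lt_one (Real.exp_pos _)]
    have h1 := hM (Complex.exp (R + s * Complex.I))
    have h2 := hM 0
    have h3 := norm_sub_le (h (Complex.exp (R + s * Complex.I)) - Complex.exp (R + s * Complex.I)) (h 0 - 0)
    have : (R + s * Complex.I : ℂ).re = R := by simp
    rw [this]; linarith
  have hηc : Continuous η := by
    refine Continuous.div (by fun_prop) (by fun_prop) fun s => Complex.exp_ne_zero _
  obtain ⟨j, hj⟩ := exists_int_of_exp_eq (T := (Set.univ : Set ℝ)) isPreconnected_univ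
    (Φ := fun s => Λ (0, R + s * Complex.I))
    (Ψ := fun s => (R + s * Complex.I) + Complex.log (η s))
    (by fun_prop)
    (by
      refine Continuous.continuousOn ?_
      exact (by fun_prop : Continuous fun s : ℝ => (R + s * Complex.I : ℂ)).add
        (hηc.clog hη))
    (by
      intro s _
      rw [hexp, Complex.exp_add (R + s * Complex.I), Complex.exp_log (Complex.slitPlane_ne_zero (hη s))]
      have e0 : Complex.exp (R + s * Complex.I) ≠ 0 := Complex.exp_ne_zero _
      simp only [η, zero_add]; field_simp)
  have h0 := hj 0 trivial
  have h1 := hj (2 * Real.pi) trivial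
  have hη2 : η (2 * Real.pi) = η 0 := by
    have := hper R
    simp only [η]
    push_cast
    rw [show (R + 2 * Real.pi * Complex.I : ℂ) = R + 2 * (Real.pi * Complex.I) by ring, this]
    simp
  have h2 := hk (0, (R : ℂ)) trivial
  have h3 := hk (x, w) trivial
  simp only at h2 h3
  rw [h3]
  have : (2 * k * (Real.pi * Complex.I) : ℂ) = 2 * (Real.pi * Complex.I) := by
    rw [hη2] at h1
    push_cast at h1 h0
    rw [show (R + 2 * Real.pi * Complex.I : ℂ) = R + 2 * (Real.pi * Complex.I) by ring, h2] at h1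
    simp only [zero_mul, add_zero] at h0
    rw [h0] at h1
    linear_combination h1
  rw [this]

theorem chord_log_symm {h : ℂ ≃ₜ ℂ} {M : ℝ} (hM : ∀ x, ‖h x - x‖ ≤ M)
    {Λ : ℂ × ℂ → ℂ} (hΛ : Continuous Λ)
    (hexp : ∀ p, Complex.exp (Λ p) = h (p.1 + Complex.exp p.2) - h p.1)
    {m : ℤ} (hm : Odd m) (x w : ℂ) :
    Λ (x + Complex.exp w, w + m * (Real.pi * Complex.I)) = Λ (x, w) + m * (Real.pi * Complex.I) := by
  have hneg : ∀ w : ℂ, Complex.exp (w + Real.pi * Complex.I) = -Complex.exp w := by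
    intro w; rw [Complex.exp_add, Complex.exp_pi_mul_I]; ring
  obtain ⟨l, -, hl⟩ := exists_odd_of_exp_eq_neg (T := (Set.univ : Set (ℂ × ℂ))) isPreconnected_univ
    (Φ := fun p => Λ (p.1 + Complex.exp p.2, p.2 + Real.pi * Complex.I)) (Ψ := Λ)
    (by fun_prop) (by fun_prop) (by
      intro p _
      simp only [hexp, hneg, add_neg_cancel_right, neg_sub])
  have l1 : (l * (Real.pi * Complex.I) : ℂ) = Real.pi * Complex.I := by
    have h1 := hl (x, w) trivial
    have h2 := hl (x + Complex.exp w, w + Real.pi * Complex.I) trivial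
    have h3 := chord_log_add_two_pi hM hΛ hexp x w
    simp only [hneg, add_neg_cancel_right] at h1 h2
    rw [show w + Real.pi * Complex.I + Real.pi * Complex.I = w + 2 * (Real.pi * Complex.I) by ring,
      h3, h1] at h2
    linear_combination -h2 / 2
  have hodd : ∀ w : ℂ, Λ (x + Complex.exp w, w + Real.pi * Complex.I) = Λ (x, w) + Real.pi * Complex.I := by
    intro w
    have := hl (x, w) trivial
    rwa [l1] at this
  have hint : ∀ (j : ℤ) (y v : ℂ), Λ (y, v + 2 * j * (Real.pi * Complex.I))
      = Λ (y, v) + 2 * j * (Real.pi * Complex.I) := by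
    intro j y
    induction j with
    | zero => simp
    | succ i ih =>
      intro v
      have := chord_log_add_two_pi hM hΛ hexp y (v + 2 * i * (Real.pi * Complex.I))
      push_cast at ih ⊢
      rw [show v + 2 * ((i : ℂ) + 1) * (Real.pi * Complex.I) = v + 2 * i * (Real.pi * Complex.I)
        + 2 * (Real.pi * Complex.I) by ring, this, ih]
      ring
    | pred i ih =>
      intro v
      have := chord_log_add_two_pi hM hΛ hexp y (v + 2 * (-i - 1) * (Real.pi * Complex.I))
      push_cast at ih ⊢
      rw [show v + 2 * (-(i : ℂ) - 1) * (Real.pi * Complex.I)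
        + 2 * (Real.pi * Complex.I) = v + 2 * (-i) * (Real.pi * Complex.I) by ring, ih] at this
      linear_combination -this
  obtain ⟨j, rfl⟩ := hm
  have := hint j (x + Complex.exp w) (w + Real.pi * Complex.I)
  push_cast
  rw [show w + (2 * (j : ℂ) + 1) * (Real.pi * Complex.I) = w + Real.pi * Complex.I
    + 2 * j * (Real.pi * Complex.I) by ring, this, hodd]
  ring

/-- A fixed point free homeomorphism of the plane at bounded distance from the identity has
compatible logarithms of its displacement and of its chords. -/
theorem exists_displacement_chord_logs {h : ℂ ≃ₜ ℂ} {M : ℝ} (hM : ∀ x, ‖h x - x‖ ≤ M)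
    (hfix : ∀ x, h x ≠ x) :
    ∃ (θ : ℂ → ℂ) (Λ : ℂ × ℂ → ℂ), Continuous θ ∧ Continuous Λ ∧
      (∀ x, Complex.exp (θ x) = h x - x) ∧
      (∀ p, Complex.exp (Λ p) = h (p.1 + Complex.exp p.2) - h p.1) ∧
      (∀ x, Λ (x, θ x) = θ (h x)) ∧
      (∀ m : ℤ, Odd m → ∀ x w : ℂ, Λ (x + Complex.exp w, w + m * (Real.pi * Complex.I))
        = Λ (x, w) + m * (Real.pi * Complex.I)) := by
  obtain ⟨θ, hθ, hθe⟩ := exists_continuousOn_log (T := (Set.univ : Set ℂ)) convex_univ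
    (φ := fun x => h x - x) (by fun_prop) (fun x _ => sub_ne_zero.2 (hfix x))
  obtain ⟨Λ, hΛ, hΛe⟩ := exists_continuousOn_log (T := (Set.univ : Set (ℂ × ℂ))) convex_univ
    (φ := fun p => h (p.1 + Complex.exp p.2) - h p.1) (by fun_prop)
    (fun p _ => sub_ne_zero.2 (by simp [h.injective.ne_iff, Complex.exp_ne_zero]))
  rw [continuousOn_univ] at hθ hΛ
  simp only [Set.mem_univ, forall_const] at hθe hΛe
  obtain ⟨k, hk⟩ := exists_int_of_exp_eq (T := (Set.univ : Set ℂ)) isPreconnected_univ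
    (Φ := fun x => Λ (x, θ x)) (Ψ := fun x => θ (h x)) (by fun_prop) (by fun_prop) (by
      intro x _
      simp only [hΛe, hθe, add_sub_cancel])
  have hshift : Complex.exp (2 * k * (Real.pi * Complex.I)) = 1 := by
    rw [Complex.exp_eq_one_iff]; exact ⟨k, by ring⟩
  have hΛ' : Continuous fun p => Λ p - 2 * k * (Real.pi * Complex.I) := by fun_prop
  have hΛe' : ∀ p : ℂ × ℂ, Complex.exp (Λ p - 2 * k * (Real.pi * Complex.I))
      = h (p.1 + Complex.exp p.2) - h p.1 := by
    intro p
    rw [Complex.exp_sub, hshift, hΛe, div_one]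
  refine ⟨θ, fun p => Λ p - 2 * k * (Real.pi * Complex.I), hθ, hΛ', hθe, hΛe', ?_, ?_⟩
  · intro x
    simp only [hk x trivial]; ring
  · intro m hm x w
    exact chord_log_symm hM hΛ' hΛe' hm x w

theorem odd_cast_mul_pi_I_ne_zero {m : ℤ} (hm : Odd m) : (m * (Real.pi * Complex.I) : ℂ) ≠ 0 := by
  have : m ≠ 0 := by rintro rfl; simp at hm
  have h1 : (m : ℂ) ≠ 0 := by exact_mod_cast this
  exact mul_ne_zero h1 (mul_ne_zero (by exact_mod_cast Real.pi_ne_zero) Complex.I_ne_zero)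

/-- No point of a free path ending at `h (h p)` can start at `p`. -/
theorem not_exists_free_path {h : ℂ ≃ₜ ℂ} {M : ℝ} (hM : ∀ x, ‖h x - x‖ ≤ M)
    (hfix : ∀ x, h x ≠ x) {γ : ℝ → ℂ} (hγ : ContinuousOn γ (Set.Icc 0 1))
    (hfree : ∀ u ∈ Set.Icc (0 : ℝ) 1, ∀ v ∈ Set.Icc (0 : ℝ) 1, h (γ v) ≠ γ u)
    (hend : γ 1 = h (h (γ 0))) : False := by
  obtain ⟨θ, Λ, hθ, hΛ, hθe, hΛe, hΛθ, hsym⟩ := exists_displacement_chord_logs hM hfix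
  have m0 : (0 : ℝ) ∈ Set.Icc (0 : ℝ) 1 := by simp
  have m1 : (1 : ℝ) ∈ Set.Icc (0 : ℝ) 1 := by simp
  have hconv : Convex ℝ (Set.Icc (0 : ℝ) 1 ×ˢ Set.Icc (0 : ℝ) 1) := (convex_Icc 0 1).prod (convex_Icc 0 1)
  obtain ⟨E₀, hE₀, hE₀e⟩ := exists_continuousOn_log hconv
    (φ := fun p => h (γ p.2) - γ p.1)
    (by
      refine ContinuousOn.sub ?_ ?_
      · exact h.continuous.comp_continuousOn (hγ.comp continuousOn_snd fun p hp => hp.2)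
      · exact hγ.comp continuousOn_fst fun p hp => hp.1)
    (fun p hp => sub_ne_zero.2 (hfree _ hp.1 _ hp.2))
  obtain ⟨k, hk⟩ := exists_int_of_exp_eq (T := Set.Icc (0 : ℝ) 1) isPreconnected_Icc
    (Φ := fun u => E₀ (u, u)) (Ψ := fun u => θ (γ u))
    (hE₀.comp (by fun_prop) fun u hu => ⟨hu, hu⟩) (hθ.comp_continuousOn hγ)
    (fun u hu => by simp only [hE₀e (u, u) ⟨hu, hu⟩, hθe])
  have hshift : Complex.exp (2 * k * (Real.pi * Complex.I)) = 1 := by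
    rw [Complex.exp_eq_one_iff]; exact ⟨k, by ring⟩
  obtain ⟨E, hE, hEe, hEθ⟩ : ∃ E : ℝ × ℝ → ℂ,
      ContinuousOn E (Set.Icc (0 : ℝ) 1 ×ˢ Set.Icc (0 : ℝ) 1) ∧
      (∀ u ∈ Set.Icc (0 : ℝ) 1, ∀ v ∈ Set.Icc (0 : ℝ) 1, Complex.exp (E (u, v)) = h (γ v) - γ u) ∧
      ∀ u ∈ Set.Icc (0 : ℝ) 1, E (u, u) = θ (γ u) := by
    refine ⟨fun p => E₀ p - 2 * k * (Real.pi * Complex.I), hE₀.sub continuousOn_const, ?_, ?_⟩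
    · intro u hu v hv
      rw [Complex.exp_sub, hshift, hE₀e (u, v) ⟨hu, hv⟩, div_one]
    · intro u hu
      have := hk u hu
      simp only [this]; ring
  obtain ⟨m, hm, hmE⟩ := exists_odd_of_exp_eq_neg (T := Set.Icc (0 : ℝ) 1) isPreconnected_Icc
    (Φ := fun u => Λ (γ u, E (u, 0))) (Ψ := fun u => E (1, u))
    (hΛ.comp_continuousOn (hγ.prodMk (hE.comp (by fun_prop) fun u hu => ⟨hu, m0⟩)))
    (hE.comp (by fun_prop) fun u hu => ⟨m1, hu⟩)
    (by
      intro u hu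
      simp only [hΛe, hEe u hu 0 m0, hEe 1 m1 u hu, add_sub_cancel, hend]
      ring)
  have e1 : θ (h (γ 0)) = E (1, 0) + m * (Real.pi * Complex.I) := by
    have := hmE 0 m0
    rw [← this, hEθ 0 m0, hΛθ]
  have e2 : γ 1 + Complex.exp (E (1, 0)) = h (γ 0) := by
    rw [hEe 1 m1 0 m0]; ring
  have e3 := hsym m hm (γ 1) (E (1, 0))
  have e4 := hmE 1 m1
  rw [e2, ← e1, hΛθ, ← hend, ← hEθ 1 m1, e4] at e3
  apply odd_cast_mul_pi_I_ne_zero hm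
  linear_combination -e3 / 2

/-- A curve moved along itself by `h` with unit time shift cannot close up to a simple closed
curve of length at least two. -/
theorem not_exists_simple_closed_orbit_curve {h : ℂ ≃ₜ ℂ} {M : ℝ} (hM : ∀ x, ‖h x - x‖ ≤ M)
    (hfix : ∀ x, h x ≠ x) {d : ℝ → ℂ} {l : ℝ} (hl : 2 ≤ l) (hd : ContinuousOn d (Set.Icc 0 l))
    (hshift : ∀ t ∈ Set.Icc 0 (l - 1), d (t + 1) = h (d t)) (hclosed : d l = d 0)
    (hinj : ∀ s t, 0 ≤ s → s < t → t < l → d s ≠ d t) : False := by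
  obtain ⟨θ, Λ, hθ, hΛ, hθe, hΛe, hΛθ, hsym⟩ := exists_displacement_chord_logs hM hfix
  let T : Set (ℝ × ℝ) := {p | 0 ≤ p.1 ∧ p.2 ≤ l ∧ 0 < p.2 - p.1 ∧ p.2 - p.1 < l}
  have hT : Convex ℝ T := by
    have c1 : Convex ℝ {p : ℝ × ℝ | 0 ≤ p.1} := convex_halfSpace_ge (LinearMap.fst ℝ ℝ ℝ).isLinear 0
    have c2 : Convex ℝ {p : ℝ × ℝ | p.2 ≤ l} := convex_halfSpace_le (LinearMap.snd ℝ ℝ ℝ).isLinear l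
    have c3 : Convex ℝ {p : ℝ × ℝ | 0 < p.2 - p.1} :=
      convex_halfSpace_gt (LinearMap.snd ℝ ℝ ℝ - LinearMap.fst ℝ ℝ ℝ).isLinear 0
    have c4 : Convex ℝ {p : ℝ × ℝ | p.2 - p.1 < l} :=
      convex_halfSpace_lt (LinearMap.snd ℝ ℝ ℝ - LinearMap.fst ℝ ℝ ℝ).isLinear l
    exact c1.inter (c2.inter (c3.inter c4))
  have hT1 : ∀ p ∈ T, p.1 ∈ Set.Icc 0 l := fun p hp => ⟨hp.1, by linarith [hp.2.1, hp.2.2.1]⟩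
  have hT2 : ∀ p ∈ T, p.2 ∈ Set.Icc 0 l := fun p hp => ⟨by linarith [hp.1, hp.2.2.1], hp.2.1⟩
  have hd1 : ContinuousOn (fun p : ℝ × ℝ => d p.1) T := hd.comp continuousOn_fst hT1
  have hd2 : ContinuousOn (fun p : ℝ × ℝ => d p.2) T := hd.comp continuousOn_snd hT2
  obtain ⟨E₀, hE₀, hE₀e⟩ := exists_continuousOn_log hT (φ := fun p => d p.2 - d p.1)
    (hd2.sub hd1) (by
      rintro ⟨s, t⟩ ⟨h1, h2, h3, h4⟩
      simp only at h1 h2 h3 h4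
      rw [sub_ne_zero]
      rcases h2.eq_or_lt with rfl | h2
      · simp only [hclosed]
        exact hinj 0 s le_rfl (by linarith) (by linarith)
      · exact (hinj s t h1 (by linarith) h2).symm)
  have hdiag : ∀ t ∈ Set.Icc 0 (l - 1), (t, t + 1) ∈ T := fun t ht =>
    ⟨ht.1, by simp only; linarith [ht.2], by simp, by simp only; linarith⟩
  obtain ⟨k, hk⟩ := exists_int_of_exp_eq (T := Set.Icc (0 : ℝ) (l - 1)) isPreconnected_Icc
    (Φ := fun t => E₀ (t, t + 1)) (Ψ := fun t => θ (d t))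
    (hE₀.comp (by fun_prop) hdiag)
    (hθ.comp_continuousOn (hd.mono (Set.Icc_subset_Icc_right (by linarith))))
    (fun t ht => by simp only [hE₀e _ (hdiag t ht), hθe, hshift t ht])
  have hk1 : Complex.exp (2 * k * (Real.pi * Complex.I)) = 1 := by
    rw [Complex.exp_eq_one_iff]; exact ⟨k, by ring⟩
  obtain ⟨E, hE, hEe, hEθ⟩ : ∃ E : ℝ × ℝ → ℂ, ContinuousOn E T ∧
      (∀ s t, (s, t) ∈ T → Complex.exp (E (s, t)) = d t - d s) ∧
      ∀ t ∈ Set.Icc 0 (l - 1), E (t, t + 1) = θ (d t) := by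
    refine ⟨fun p => E₀ p - 2 * k * (Real.pi * Complex.I), hE₀.sub continuousOn_const, ?_, ?_⟩
    · intro s t hst
      rw [Complex.exp_sub, hk1, hE₀e (s, t) hst, div_one]
    · intro u hu
      have := hk u hu
      simp only [this]; ring
  obtain ⟨m, hm, hmE⟩ := exists_odd_of_exp_eq_neg (T := Set.Ioo (0 : ℝ) l) isPreconnected_Ioo
    (Φ := fun s => E (s, l)) (Ψ := fun s => E (0, s))
    (hE.comp (by fun_prop) fun s hs => ⟨hs.1.le, le_rfl, sub_pos.2 hs.2, by simp only; linarith [hs.1]⟩)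
    (hE.comp (by fun_prop) fun s hs => ⟨le_rfl, hs.2.le, by simpa using hs.1, by simpa using hs.2⟩)
    (by
      intro s hs
      rw [hEe _ _ ⟨hs.1.le, le_rfl, sub_pos.2 hs.2, by simp only; linarith [hs.1]⟩,
        hEe _ _ ⟨le_rfl, hs.2.le, by simpa using hs.1, by simpa using hs.2⟩, hclosed]
      ring)
  -- on the common domain the chord logarithms agree with their images
  let T' : Set (ℝ × ℝ) := {p | 0 ≤ p.1 ∧ p.2 ≤ l - 1 ∧ 0 < p.2 - p.1}
  have hT' : Convex ℝ T' := by
    have c1 : Convex ℝ {p : ℝ × ℝ | 0 ≤ p.1} := convex_halfSpace_ge (LinearMap.fst ℝ ℝ ℝ).isLinear 0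
    have c2 : Convex ℝ {p : ℝ × ℝ | p.2 ≤ l - 1} :=
      convex_halfSpace_le (LinearMap.snd ℝ ℝ ℝ).isLinear (l - 1)
    have c3 : Convex ℝ {p : ℝ × ℝ | 0 < p.2 - p.1} :=
      convex_halfSpace_gt (LinearMap.snd ℝ ℝ ℝ - LinearMap.fst ℝ ℝ ℝ).isLinear 0
    exact c1.inter (c2.inter c3)
  have hTT : ∀ p ∈ T', p ∈ T := fun p hp =>
    ⟨hp.1, by linarith [hp.2.1], hp.2.2, by linarith [hp.1, hp.2.1]⟩
  have hTs : ∀ p ∈ T', (p.1 + 1, p.2 + 1) ∈ T := fun p hp =>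
    ⟨by simp only; linarith [hp.1], by simp only; linarith [hp.2.1],
      by simp only; linarith [hp.2.2], by simp only; linarith [hp.1, hp.2.1]⟩
  obtain ⟨j, hj⟩ := exists_int_of_exp_eq hT'.isPreconnected
    (Φ := fun p => Λ (d p.1, E p)) (Ψ := fun p => E (p.1 + 1, p.2 + 1))
    (hΛ.comp_continuousOn ((hd1.mono hTT).prodMk (hE.mono hTT)))
    (hE.comp (by fun_prop) hTs)
    (by
      rintro ⟨s, t⟩ hp
      have h1 := hp.1
      have h2 := hp.2.1
      have h3 := hp.2.2
      simp only at h1 h2 h3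
      simp only [hΛe, hEe _ _ (hTT _ hp), hEe _ _ (hTs _ hp), add_sub_cancel]
      rw [hshift s ⟨h1, by linarith⟩, hshift t ⟨by linarith, h2⟩])
  have z0 : (0 : ℝ) ∈ Set.Icc 0 (l - 1) := ⟨le_rfl, by linarith⟩
  have z1 : (1 : ℝ) ∈ Set.Icc 0 (l - 1) := ⟨by norm_num, by linarith⟩
  have zl : l - 1 ∈ Set.Icc 0 (l - 1) := ⟨by linarith, le_rfl⟩
  have hj0 := hj (0, 1) ⟨le_rfl, by simp only; linarith, by simp⟩
  have hE01 := hEθ 0 z0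
  have hE12 := hEθ 1 z1
  have hd01 := hshift 0 z0
  rw [zero_add] at hE01 hd01
  simp only [zero_add] at hj0
  rw [hE01, hΛθ, hE12, hd01] at hj0
  have hj1 := hj (0, l - 1) ⟨le_rfl, by simp, by simp only; linarith⟩
  simp only [zero_add, sub_add_cancel] at hj1
  have hl1 := hEθ (l - 1) zl
  have hdl := hshift (l - 1) zl
  rw [sub_add_cancel] at hl1 hdl
  have hm1 := hmE (l - 1) ⟨by linarith, by linarith⟩
  have hm2 := hmE 1 ⟨by norm_num, by linarith⟩
  have hs := hsym m hm (d 0) (E (0, l - 1))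
  rw [hEe 0 (l - 1) ⟨le_rfl, by simp, by simp only; linarith, by simp only; linarith⟩,
    add_sub_cancel, ← hm1, hl1, hΛθ, ← hdl, hclosed, hj1, hm2, hE01] at hs
  apply odd_cast_mul_pi_I_ne_zero hm
  linear_combination -hs / 2 + hj0 / 2

/-- A fixed point free plane homeomorphism has a translation arc through every point. -/
theorem exists_translation_arc {h : ℂ ≃ₜ ℂ} {M : ℝ} (hM : ∀ x, ‖h x - x‖ ≤ M)
    (hfix : ∀ x, h x ≠ x) (x₀ : ℂ) :
    ∃ β : ℝ → ℂ, Continuous β ∧ β (1 / 2) = x₀ ∧ β 1 = h (β 0) ∧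
      (∀ s ∈ Set.Icc (0 : ℝ) 1, ∀ t ∈ Set.Icc (0 : ℝ) 1, β s = β t → s = t) ∧
      (∀ s ∈ Set.Icc (0 : ℝ) 1, ∀ t ∈ Set.Icc (0 : ℝ) 1, h (β s) = β t → s = 0 ∧ t = 1) := by
  have hψ : Continuous fun p : ℂ => max (dist p x₀) (dist (h p) x₀) := by fun_prop
  obtain ⟨z, hz⟩ := hψ.exists_forall_le (tendsto_atTop_mono (fun p => le_max_left _ _)
    (tendsto_dist_right_cocompact_atTop x₀))
  obtain ⟨r, hr⟩ : ∃ r, r = max (dist z x₀) (dist (h z) x₀) := ⟨_, rfl⟩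
  simp only [← hr] at hz
  have hzr : dist z x₀ ≤ r := hr ▸ le_max_left _ _
  have hhzr : dist (h z) x₀ ≤ r := hr ▸ le_max_right _ _
  have hr0 : 0 < r := by
    by_contra hneg
    have h1 : z = x₀ := dist_le_zero.1 (hzr.trans (not_lt.1 hneg))
    have h2 : h z = x₀ := dist_le_zero.1 (hhzr.trans (not_lt.1 hneg))
    exact hfix z (h2.trans h1.symm)
  have hno : ∀ p, dist p x₀ < r → dist (h p) x₀ < r → False := fun p h1 h2 =>
    absurd (hz p) (not_le.2 (max_lt h1 h2))
  have hcl : closure (Metric.ball x₀ r) = Metric.closedBall x₀ r := closure_ball x₀ hr0.ne'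
  have hsphere : ∀ p, dist p x₀ ≤ r → dist (h p) x₀ ≤ r → dist p x₀ = r ∧ dist (h p) x₀ = r := by
    intro p h1 h2
    constructor
    · by_contra hne
      have hlt := lt_of_le_of_ne h1 hne
      have hp : p ∈ closure (h ⁻¹' Metric.ball x₀ r) := by
        rw [← h.preimage_closure, hcl]; exact h2
      obtain ⟨q, hq1, hq2⟩ := mem_closure_iff.1 hp _ Metric.isOpen_ball (Metric.mem_ball.2 hlt)
      exact hno q hq1 hq2
    · by_contra hne
      have hlt := lt_of_le_of_ne h2 hne
      have hp : p ∈ closure (Metric.ball x₀ r) := by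
        rw [hcl]; exact h1
      obtain ⟨q, hq1, hq2⟩ := mem_closure_iff.1 hp (h ⁻¹' Metric.ball x₀ r)
        (Metric.isOpen_ball.preimage h.continuous) hlt
      exact hno q hq2 hq1
  obtain ⟨ez, ehz⟩ := hsphere z hzr hhzr
  rw [dist_eq_norm] at ez ehz
  let β : ℝ → ℂ := fun t => x₀ + ((max (1 - 2 * t) 0 : ℝ) : ℂ) * (z - x₀)
    + ((max (2 * t - 1) 0 : ℝ) : ℂ) * (h z - x₀)
  have hβ1 : ∀ t ≤ 1 / 2, β t = x₀ + ((1 - 2 * t : ℝ) : ℂ) * (z - x₀) := by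
    intro t ht
    simp only [β]
    rw [max_eq_left (by linarith), max_eq_right (by linarith)]; simp
  have hβ2 : ∀ t, 1 / 2 ≤ t → β t = x₀ + ((2 * t - 1 : ℝ) : ℂ) * (h z - x₀) := by
    intro t ht
    simp only [β]
    rw [max_eq_right (by linarith), max_eq_left (by linarith)]; simp
  have hd1 : ∀ t ≤ 1 / 2, dist (β t) x₀ = (1 - 2 * t) * r := by
    intro t ht
    rw [hβ1 t ht, dist_eq_norm, add_sub_cancel_left, norm_mul, Complex.norm_real, ez,
      Real.norm_of_nonneg (by linarith)]
  have hd2 : ∀ t, 1 / 2 ≤ t → dist (β t) x₀ = (2 * t - 1) * r := by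
    intro t ht
    rw [hβ2 t ht, dist_eq_norm, add_sub_cancel_left, norm_mul, Complex.norm_real, ehz,
      Real.norm_of_nonneg (by linarith)]
  have hβ0 : β 0 = z := by rw [hβ1 0 (by norm_num)]; simp
  have hβe : β 1 = h z := by rw [hβ2 1 (by norm_num)]; norm_num
  have hle : ∀ t ∈ Set.Icc (0 : ℝ) 1, dist (β t) x₀ ≤ r := by
    rintro t ⟨h0, h1⟩
    rcases le_total t (1 / 2) with h | h
    · rw [hd1 t h]; nlinarith
    · rw [hd2 t h]; nlinarith
  have hend : ∀ t ∈ Set.Icc (0 : ℝ) 1, dist (β t) x₀ = r → t = 0 ∨ t = 1 := by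
    rintro t ⟨h0, h1⟩ ht
    rcases le_total t (1 / 2) with h | h
    · rw [hd1 t h] at ht; left
      have : (t : ℝ) * r = 0 := by linarith
      exact (mul_eq_zero.1 this).resolve_right hr0.ne'
    · rw [hd2 t h] at ht; right
      have : ((t : ℝ) - 1) * r = 0 := by linarith
      linarith [(mul_eq_zero.1 this).resolve_right hr0.ne']
  have hmix : ∀ s t : ℝ, s ≤ 1 / 2 → 1 / 2 ≤ t → β s = β t → s = t := by
    intro s t hs ht he
    have e1 : (1 - 2 * s) * r = (2 * t - 1) * r := by rw [← hd1 s hs, ← hd2 t ht, he]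
    have e2 : 1 - 2 * s = 2 * t - 1 := mul_right_cancel₀ hr0.ne' e1
    rw [hβ1 s hs, hβ2 t ht, ← e2, add_right_inj] at he
    by_cases h0 : 1 - 2 * s = 0
    · linarith
    · have := mul_left_cancel₀ (Complex.ofReal_ne_zero.2 h0) he
      exact absurd (sub_left_injective this).symm (hfix z)
  have hz0 : z - x₀ ≠ 0 := by rw [← norm_pos_iff, ez]; exact hr0
  have hhz0 : h z - x₀ ≠ 0 := by rw [← norm_pos_iff, ehz]; exact hr0
  refine ⟨β, by fun_prop, by rw [hβ1 _ le_rfl]; simp, by rw [hβe, hβ0], ?_, ?_⟩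
  · intro s hs t ht he
    rcases le_total s (1 / 2) with h1 | h1 <;> rcases le_total t (1 / 2) with h2 | h2
    · rw [hβ1 s h1, hβ1 t h2, add_right_inj] at he
      have := Complex.ofReal_injective (mul_right_cancel₀ hz0 he)
      linarith
    · exact hmix s t h1 h2 he
    · exact (hmix t s h2 h1 he.symm).symm
    · rw [hβ2 s h1, hβ2 t h2, add_right_inj] at he
      have := Complex.ofReal_injective (mul_right_cancel₀ hhz0 he)
      linarith
  · intro s hs t ht he
    obtain ⟨a1, a2⟩ := hsphere (β s) (hle s hs) (he ▸ hle t ht)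
    rw [he] at a2
    rcases hend s hs a1 with rfl | rfl <;> rcases hend t ht a2 with rfl | rfl
    · exact absurd he (hfix _)
    · simp
    · rw [hβe, hβ0] at he
      exact (not_exists_free_path hM hfix (γ := fun _ => z) continuousOn_const
        (fun _ _ _ _ => hfix z) he.symm).elim
    · exact absurd he (hfix _)

/-- **Brouwer**: a fixed point free plane homeomorphism without monodromy has no periodic
point. -/
theorem iterate_ne_of_fixedPointFree {h : ℂ ≃ₜ ℂ} {M : ℝ} (hM : ∀ x, ‖h x - x‖ ≤ M)
    (hfix : ∀ x, h x ≠ x) (x₀ : ℂ) {n : ℕ} (hn : 1 ≤ n) : h^[n] x₀ ≠ x₀ := by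
  intro hper
  obtain ⟨β, hβ, hβm, hβ1, hinj, hfree⟩ := exists_translation_arc hM hfix x₀
  let d : ℝ → ℂ := fun t => h^[⌊t⌋₊] (β (t - ⌊t⌋₊))
  have hdk : ∀ (k : ℕ) (t : ℝ), k ≤ t → t ≤ k + 1 → d t = h^[k] (β (t - k)) := by
    intro k t h1 h2
    rcases h2.eq_or_lt with rfl | h2
    · have : ⌊(k : ℝ) + 1⌋₊ = k + 1 := by exact_mod_cast Nat.floor_natCast (k + 1)
      simp only [d, this]
      rw [Function.iterate_succ_apply]
      simp [hβ1]
    · have : ⌊t⌋₊ = k := (Nat.floor_eq_iff (by linarith [k.cast_nonneg (α := ℝ)])).2 ⟨h1, h2⟩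
      simp only [d, this]
  have hdc : ∀ N : ℕ, ContinuousOn d (Set.Icc 0 N) := by
    intro N
    induction N with
    | zero => simp
    | succ N ih =>
      have hu : Set.Icc (0 : ℝ) ((N + 1 : ℕ) : ℝ) = Set.Icc (0 : ℝ) N ∪ Set.Icc (N : ℝ) (N + 1) := by
        rw [Set.Icc_union_Icc_eq_Icc (by positivity) (by linarith)]; simp
      rw [hu]
      refine ih.union_of_isClosed ?_ isClosed_Icc isClosed_Icc
      refine ContinuousOn.congr (f := fun t : ℝ => h^[N] (β (t - N))) ?_
        (fun t ht => hdk N t ht.1 ht.2)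
      exact ((h.continuous.iterate N).comp (hβ.comp (by fun_prop))).continuousOn
  have hds : ∀ t, 0 ≤ t → d (t + 1) = h (d t) := by
    intro t ht
    simp only [d]
    rw [Nat.floor_add_one ht, Function.iterate_succ_apply']
    push_cast
    rw [add_sub_add_right_eq_sub]
  have hdsk : ∀ (k : ℕ) (t : ℝ), 0 ≤ t → d (t + k) = h^[k] (d t) := by
    intro k
    induction k with
    | zero => intro t _; simp
    | succ k ih =>
      intro t ht
      rw [Function.iterate_succ_apply', ← ih t ht, ← hds _ (by positivity)]
      push_cast; rw [add_assoc]
  have hd01 : ∀ t, 0 ≤ t → t ≤ 1 → d t = β t := by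
    intro t h1 h2
    have := hdk 0 t (by simpa using h1) (by simpa using h2)
    simpa using this
  -- shifting a coincidence into the first unit interval
  have hnorm : ∀ s t, 0 ≤ s → s < t → d s = d t →
      ∃ s' t', 0 ≤ s' ∧ s' < 1 ∧ t' - s' = t - s ∧ d s' = d t' := by
    intro s t hs hst he
    have hf := Nat.floor_le hs
    have hf' := Nat.lt_floor_add_one s
    refine ⟨s - ⌊s⌋₊, t - ⌊s⌋₊, by linarith, by linarith, by ring, ?_⟩
    have e1 := hdsk ⌊s⌋₊ (s - ⌊s⌋₊) (by linarith)
    have e2 := hdsk ⌊s⌋₊ (t - ⌊s⌋₊) (by linarith)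
    rw [sub_add_cancel] at e1 e2
    exact h.injective.iterate _ (by rw [← e1, ← e2, he])
  have hgap : ∀ s t, 0 ≤ s → s < t → d s = d t → 2 < t - s := by
    intro s t hs hst he
    obtain ⟨s', t', h0, h1, h2, h3⟩ := hnorm s t hs hst he
    rw [← h2]
    have hlt : s' < t' := by linarith
    clear h2 he hst hs s t
    rw [hd01 s' h0 h1.le] at h3
    rcases le_or_gt t' 1 with h4 | h4
    · rw [hd01 t' (by linarith) h4] at h3
      exact absurd (hinj s' ⟨h0, h1.le⟩ t' ⟨by linarith, h4⟩ h3) hlt.ne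
    rcases le_or_gt t' 2 with h5 | h5
    · have := hdk 1 t' (by simpa using h4.le) (by norm_num; linarith)
      rw [this] at h3
      have := (hfree (t' - 1) ⟨by linarith, by linarith⟩ s' ⟨h0, h1.le⟩ (by simpa using h3.symm)).2
      exact absurd this h1.ne
    rcases lt_or_ge t' 3 with h6 | h6
    · have := hdk 2 t' (by simpa using h5.le) (by norm_num; linarith)
      rw [this] at h3
      have hmem : ∀ u ∈ Set.Icc (0 : ℝ) 1, t' - 2 + u * (s' - (t' - 2)) ∈ Set.Ico (0 : ℝ) 1 := by
        intro u hu
        exact (convex_Ico (0 : ℝ) 1).add_smul_sub_mem ⟨by linarith, by linarith⟩ ⟨h0, h1⟩ hu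
      refine (not_exists_free_path hM hfix (γ := fun u => β (t' - 2 + u * (s' - (t' - 2))))
        (by fun_prop) ?_ ?_).elim
      · intro u hu v hv he
        exact absurd (hfree _ ⟨(hmem v hv).1, (hmem v hv).2.le⟩ _ ⟨(hmem u hu).1, (hmem u hu).2.le⟩ he).2
          (hmem u hu).2.ne
      · simpa using h3
    · linarith
  have hn1 : (1 : ℝ) ≤ n := by exact_mod_cast hn
  let K : Set (ℝ × ℝ) := (Set.Icc (0 : ℝ) 1 ×ˢ Set.Icc (0 : ℝ) ((n + 1 : ℕ) : ℝ)) ∩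
    ({p | p.1 + 1 ≤ p.2} ∩ (fun p : ℝ × ℝ => (d p.1, d p.2)) ⁻¹' Set.diagonal ℂ)
  have hK : IsCompact K := by
    have hbox : IsCompact (Set.Icc (0 : ℝ) 1 ×ˢ Set.Icc (0 : ℝ) ((n + 1 : ℕ) : ℝ)) :=
      isCompact_Icc.prod isCompact_Icc
    have hcl : IsClosed {p : ℝ × ℝ | p.1 + 1 ≤ p.2} := isClosed_le (by fun_prop) (by fun_prop)
    have hco : ContinuousOn (fun p : ℝ × ℝ => (d p.1, d p.2))
        (Set.Icc (0 : ℝ) 1 ×ˢ Set.Icc (0 : ℝ) ((n + 1 : ℕ) : ℝ)) := by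
      refine ContinuousOn.prodMk ((hdc 1).comp continuousOn_fst fun p hp => ?_)
        ((hdc (n + 1)).comp continuousOn_snd fun p hp => hp.2)
      simpa using hp.1
    have := hco.preimage_isClosed_of_isClosed hbox.isClosed isClosed_diagonal
    have e : K = (Set.Icc (0 : ℝ) 1 ×ˢ Set.Icc (0 : ℝ) ((n + 1 : ℕ) : ℝ)) ∩
        (((Set.Icc (0 : ℝ) 1 ×ˢ Set.Icc (0 : ℝ) ((n + 1 : ℕ) : ℝ)) ∩
          (fun p : ℝ × ℝ => (d p.1, d p.2)) ⁻¹' Set.diagonal ℂ) ∩ {p | p.1 + 1 ≤ p.2}) := by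
      ext p; simp only [K, Set.mem_inter_iff]; tauto
    rw [e]
    exact hbox.inter_right (this.inter hcl)
  have hhalf : ((1 / 2 : ℝ), (1 / 2 + n : ℝ)) ∈ K := by
    refine ⟨⟨⟨by norm_num, by norm_num⟩, by simp only; positivity, ?_⟩, ?_, ?_⟩
    · push_cast; linarith
    · simp only [Set.mem_ofPred_eq]; linarith
    · simp only [Set.mem_preimage, Set.mem_diagonal_iff]
      rw [hdsk n _ (by norm_num), hd01 _ (by norm_num) (by norm_num), hβm, hper]
  obtain ⟨⟨s₀, t₀⟩, hst, hmin⟩ := hK.exists_isMinOn ⟨_, hhalf⟩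
    (f := fun p : ℝ × ℝ => p.2 - p.1) (by fun_prop)
  obtain ⟨⟨⟨hs0, hs1⟩, ht0, ht1⟩, hge, heq⟩ := hst
  simp only [Set.mem_preimage, Set.mem_diagonal_iff, Set.mem_ofPred_eq] at hs0 hs1 ht0 ht1 hge heq
  have hle_n : t₀ - s₀ ≤ n := by
    have := isMinOn_iff.1 hmin _ hhalf
    simp only at this
    linarith
  have h2 : 2 < t₀ - s₀ := hgap s₀ t₀ hs0 (by linarith) heq
  have hminimal : ∀ s t, 0 ≤ s → s < t → d s = d t → t₀ - s₀ ≤ t - s := by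
    intro s t hs hst he
    have hg := hgap s t hs hst he
    obtain ⟨s', t', h0, h1, h3, h4⟩ := hnorm s t hs hst he
    rw [← h3]
    by_cases ht : t' ≤ n + 1
    · have := isMinOn_iff.1 hmin (s', t') ⟨⟨⟨h0, h1.le⟩, by simp only; linarith, by simpa using ht⟩,
        by simp only [Set.mem_ofPred_eq]; linarith, h4⟩
      exact this
    · linarith
  refine not_exists_simple_closed_orbit_curve hM hfix (d := fun u => d (s₀ + u)) (l := t₀ - s₀)
    h2.le ?_ ?_ ?_ ?_
  · refine (hdc (n + 1)).comp (by fun_prop) fun u hu => ⟨by linarith [hu.1], by linarith [hu.2]⟩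
  · intro t ht
    rw [← add_assoc, hds _ (by linarith [ht.1])]
  · simp [heq]
  · intro s t h0 h1 h3 he
    have := hminimal (s₀ + s) (s₀ + t) (by linarith) (by linarith) he
    linarith

/-- Bounded real data on a separated set extends to a bounded Lipschitz function. -/
theorem exists_lipschitz_interpolation {X ι : Type*} [PseudoMetricSpace X] {c : ι → X} {w : ι → ℝ}
    {κ η : ℝ} (hη : 0 < η) (hκ : 8 * κ ≤ η) (hw : ∀ i, |w i| ≤ κ) (hκ0 : 0 ≤ κ)
    (hsep : ∀ i j, i ≠ j → η ≤ dist (c i) (c j)) :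
    ∃ g : X → ℝ, LipschitzWith (1 / 4) g ∧ (∀ i, g (c i) = w i) ∧ ∀ x, |g x| ≤ κ := by
  have hinj : Function.Injective c := by
    intro i j hij
    by_contra hne
    have := hsep i j hne
    rw [hij, dist_self] at this
    linarith
  have hL : LipschitzOnWith (1 / 4) (Function.extend c w 0) (Set.range c) := by
    refine LipschitzOnWith.of_dist_le_mul ?_
    rintro _ ⟨i, rfl⟩ _ ⟨j, rfl⟩
    rw [hinj.extend_apply, hinj.extend_apply]
    by_cases hij : i = j
    · simp [hij]
    · have h1 := hsep i j hij
      have h2 := abs_le.1 (hw i)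
      have h3 := abs_le.1 (hw j)
      have : dist (w i) (w j) ≤ 2 * κ := by
        rw [Real.dist_eq, abs_le]; constructor <;> linarith
      have e : ((1 / 4 : NNReal) : ℝ) = 1 / 4 := by norm_num
      rw [e]; linarith
  obtain ⟨g, hg, hge⟩ := hL.extend_real
  refine ⟨fun x => max (-κ) (min κ (g x)), (hg.const_min κ).const_max (-κ), ?_, ?_⟩
  · intro i
    have : g (c i) = w i := by rw [← hge ⟨i, rfl⟩, hinj.extend_apply]
    obtain ⟨h1, h2⟩ := abs_le.1 (hw i)
    simp only [this]
    rw [min_eq_right h2, max_eq_right h1]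
  · intro x
    rw [abs_le]
    exact ⟨le_max_left _ _, max_le (by linarith) (min_le_left _ _)⟩

/-- Separated points can be moved a little by a small plane homeomorphism. -/
theorem exists_small_homeomorph_add {ι : Type*} {c v : ι → ℂ} {κ η : ℝ} (hη : 0 < η)
    (hκ : 8 * κ ≤ η) (hκ0 : 0 ≤ κ) (hv : ∀ i, ‖v i‖ ≤ κ)
    (hsep : ∀ i j, i ≠ j → η ≤ dist (c i) (c j)) :
    ∃ g : ℂ ≃ₜ ℂ, (∀ x, dist (g x) x ≤ 2 * κ) ∧ ∀ i, g (c i) = c i + v i := by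
  obtain ⟨a, ha, hac, hab⟩ := exists_lipschitz_interpolation (w := fun i => (v i).re) hη hκ
    (fun i => (Complex.abs_re_le_norm _).trans (hv i)) hκ0 hsep
  obtain ⟨b, hb, hbc, hbb⟩ := exists_lipschitz_interpolation (w := fun i => (v i).im) hη hκ
    (fun i => (Complex.abs_im_le_norm _).trans (hv i)) hκ0 hsep
  let u : ℂ → ℂ := fun x => a x + b x * Complex.I
  have happrox : ApproximatesLinearOn (fun x => x + u x)
      ((ContinuousLinearEquiv.refl ℝ ℂ : ℂ ≃L[ℝ] ℂ) : ℂ →L[ℝ] ℂ) Set.univ (1 / 2) := by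
    intro x _ y _
    have h1 := ha.dist_le_mul x y
    have h2 := hb.dist_le_mul x y
    rw [Real.dist_eq, dist_eq_norm] at h1 h2
    have e : x + u x - (y + u y) - ((ContinuousLinearEquiv.refl ℝ ℂ : ℂ ≃L[ℝ] ℂ) : ℂ →L[ℝ] ℂ) (x - y)
        = ((a x - a y : ℝ) : ℂ) + ((b x - b y : ℝ) : ℂ) * Complex.I := by
      simp [u]; ring
    rw [e]
    refine (norm_add_le _ _).trans ?_
    rw [norm_mul, Complex.norm_real, Complex.norm_real, Complex.norm_I, mul_one,
      Real.norm_eq_abs, Real.norm_eq_abs]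
    push_cast at h1 h2 ⊢
    linarith
  have hN : ‖(((ContinuousLinearEquiv.refl ℝ ℂ : ℂ ≃L[ℝ] ℂ).symm : ℂ ≃L[ℝ] ℂ) : ℂ →L[ℝ] ℂ)‖₊ = 1 := by
    ext
    exact ContinuousLinearMap.norm_id
  let g : ℂ ≃ₜ ℂ := happrox.toHomeomorph _ (Or.inr (by
    rw [hN]; rw [← NNReal.coe_lt_coe]; norm_num))
  have hg : ∀ x, g x = x + u x := fun x => rfl
  refine ⟨g, fun x => ?_, fun i => ?_⟩
  · rw [hg, dist_eq_norm, add_sub_cancel_left]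
    refine (norm_add_le _ _).trans ?_
    rw [norm_mul, Complex.norm_real, Complex.norm_real, Complex.norm_I, mul_one,
      Real.norm_eq_abs, Real.norm_eq_abs]
    linarith [hab x, hbb x]
  · rw [hg]
    simp only [u, hac, hbc, Complex.re_add_im]

/-- Finitely many points can be pushed simultaneously to nearby targets by a small plane
homeomorphism, provided no point is close to the target of another one. -/
theorem exists_small_homeomorph_map {ι : Type*} [Finite ι] {Z Y : ι → ℂ} {ε : ℝ} (hε : 0 < ε)
    (hclose : ∀ i, dist (Z i) (Y i) < ε) (hfar : ∀ i j, i ≠ j → ε ≤ dist (Z i) (Y j)) :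
    ∃ g : ℂ ≃ₜ ℂ, (∀ x, dist (g x) x ≤ 2 * ε) ∧ ∀ i, g (Z i) = Y i := by
  rcases isEmpty_or_nonempty ι with hι | hι
  · exact ⟨Homeomorph.refl ℂ, fun x => by simp [hε.le], fun i => hι.elim i⟩
  obtain ⟨i₀, hi₀⟩ := Finite.exists_max fun i => dist (Z i) (Y i)
  obtain ⟨η, hη⟩ : ∃ η, η = ε - dist (Z i₀) (Y i₀) := ⟨_, rfl⟩
  have hη0 : 0 < η := by rw [hη]; linarith [hclose i₀]
  have hclose' : ∀ i, ‖Y i - Z i‖ ≤ ε - η := by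
    intro i; rw [← dist_eq_norm, dist_comm, hη]; linarith [hi₀ i]
  obtain ⟨K, hK⟩ := exists_nat_gt (8 * ε / η)
  have hK0 : (0 : ℝ) < K := lt_of_le_of_lt (by positivity) hK
  have hκ : 8 * (ε / K) ≤ η := by
    rw [div_lt_iff₀ hη0] at hK
    rw [← mul_div_assoc, div_le_iff₀ hK0]; linarith
  have hsep : ∀ t : ℝ, 0 ≤ t → t ≤ 1 → ∀ i j, i ≠ j →
      η ≤ dist (Z i + (t : ℂ) * (Y i - Z i)) (Z j + (t : ℂ) * (Y j - Z j)) := by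
    intro t h0 h1 i j hij
    have h2 := hfar i j hij
    have e : Z i - Y j = (Z i + (t : ℂ) * (Y i - Z i) - (Z j + (t : ℂ) * (Y j - Z j)))
        - (t : ℂ) * (Y i - Z i) - ((1 - t : ℝ) : ℂ) * (Y j - Z j) := by push_cast; ring
    rw [dist_eq_norm, e] at h2
    rw [dist_eq_norm]
    have h3 := (h2.trans (norm_sub_le _ _)).trans (add_le_add_left (norm_sub_le _ _) _)
    rw [norm_mul, norm_mul, Complex.norm_real, Complex.norm_real, Real.norm_of_nonneg h0,
      Real.norm_of_nonneg (by linarith : (0 : ℝ) ≤ 1 - t)] at h3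
    have h4 := mul_le_mul_of_nonneg_left (hclose' i) h0
    have h5 := mul_le_mul_of_nonneg_left (hclose' j) (by linarith : (0 : ℝ) ≤ 1 - t)
    linarith
  have key : ∀ k : ℕ, k ≤ K → ∃ g : ℂ ≃ₜ ℂ, (∀ x, dist (g x) x ≤ k * (2 * (ε / K))) ∧
      ∀ i, g (Z i) = Z i + ((k / K : ℝ) : ℂ) * (Y i - Z i) := by
    intro k
    induction k with
    | zero => intro _; exact ⟨Homeomorph.refl ℂ, fun x => by simp, fun i => by simp⟩
    | succ k ih =>
      intro hk
      obtain ⟨g, hg, hgZ⟩ := ih (by omega)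
      obtain ⟨g', hg', hgc⟩ := exists_small_homeomorph_add (κ := ε / K)
        (c := fun i => Z i + ((k / K : ℝ) : ℂ) * (Y i - Z i))
        (v := fun i => ((1 / K : ℝ) : ℂ) * (Y i - Z i)) hη0 hκ (by positivity)
        (by
          intro i
          rw [norm_mul, Complex.norm_real, Real.norm_of_nonneg (by positivity), div_mul_eq_mul_div,
            one_mul]
          have := hclose' i
          gcongr
          linarith)
        (hsep _ (by positivity) (by
          rw [div_le_one hK0]; exact_mod_cast (by omega : k ≤ K)))
      refine ⟨g.trans g', fun x => ?_, fun i => ?_⟩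
      · have h1 := hg x
        have h2 := hg' (g x)
        have h3 := dist_triangle (g' (g x)) (g x) x
        simp only [Homeomorph.trans_apply]
        push_cast
        linarith
      · simp only [Homeomorph.trans_apply]
        rw [hgZ, hgc]; push_cast; ring
  obtain ⟨g, hg, hgZ⟩ := key K le_rfl
  refine ⟨g, fun x => (hg x).trans (le_of_eq (by field_simp)), fun i => ?_⟩
  rw [hgZ, div_self hK0.ne']; simp

theorem exists_sequence_of_transGen {X : Type*} {R : X → X → Prop} {a b : X}
    (h : Relation.TransGen R a b) :
    ∃ (n : ℕ) (x : ℕ → X), 1 ≤ n ∧ x 0 = a ∧ x n = b ∧ ∀ i < n, R (x i) (x (i + 1)) := by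
  induction h with
  | single h =>
    rename_i b
    refine ⟨1, fun i => if i = 0 then a else b, le_rfl, by simp, by simp, fun i hi => ?_⟩
    obtain rfl : i = 0 := by omega
    simpa using h
  | tail _ h ih =>
    rename_i b c _
    obtain ⟨n, x, hn, h0, h1, h2⟩ := ih
    refine ⟨n + 1, fun i => if i ≤ n then x i else c, by omega, by simp [h0], by simp, ?_⟩
    intro i hi
    rcases (Nat.lt_succ_iff.1 hi).eq_or_lt with rfl | hlt
    · simpa [h1] using h
    · have e1 : i ≤ n := hlt.le
      have e2 : i + 1 ≤ n := hlt
      simpa [e1, e2] using h2 i hlt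

/-- **Franks lemma**: a plane homeomorphism moving every point by at least `δ` and at most `M` has
no closed `δ / 4`-chain. -/
theorem not_closed_chain_plane {h : ℂ ≃ₜ ℂ} {M δ : ℝ} (hM : ∀ x, ‖h x - x‖ ≤ M) (hδ : 0 < δ)
    (hδh : ∀ x, δ ≤ dist (h x) x) (x₀ : ℂ) :
    ¬ Relation.TransGen (fun x y => dist (h x) y < δ / 4) x₀ x₀ := by
  intro hch
  let P : ℕ → Prop := fun n => 1 ≤ n ∧ ∃ x : ℕ → ℂ, x n = x 0 ∧
    ∀ i < n, dist (h (x i)) (x (i + 1)) < δ / 4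
  have hP : ∃ n, P n := by
    obtain ⟨n, x, hn, h0, h1, h2⟩ := exists_sequence_of_transGen hch
    exact ⟨n, hn, x, h1.trans h0.symm, h2⟩
  classical
  obtain ⟨hn, x, hx0, hx⟩ := Nat.find_spec hP
  have hmin : ∀ m < Nat.find hP, ¬ P m := fun m hm => Nat.find_min hP hm
  generalize Nat.find hP = n at hn hx0 hx hmin
  obtain ⟨g, hg, hgZ⟩ := exists_small_homeomorph_map (ι := Fin n) (Z := fun i => h (x i))
    (Y := fun i => x (i + 1)) (ε := δ / 4) (by positivity) (fun i => hx i i.2) (by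
      rintro ⟨i, hi⟩ ⟨j, hj⟩ hij
      simp only
      by_contra hlt
      rw [not_le] at hlt
      have hne : i ≠ j := fun h => hij (by simp [h])
      rcases lt_or_gt_of_ne hne with hij | hij
      · refine hmin (n - (j - i)) (by omega) ⟨by omega,
          fun k => if k ≤ i then x k else x (k + (j - i)), ?_, fun k hk => ?_⟩
        · have e1 : ¬ n - (j - i) ≤ i := by omega
          have e2 : n - (j - i) + (j - i) = n := by omega
          simp only [e1, if_false, e2, Nat.zero_le, if_true, hx0]
        · rcases lt_trichotomy k i with hki | rfl | hki
          · have e1 : k ≤ i := hki.le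
            have e2 : k + 1 ≤ i := hki
            simp only [e1, e2, if_true]
            exact hx k (by omega)
          · have e2 : k + 1 + (j - k) = j + 1 := by omega
            simpa [e2] using hlt
          · have e1 : ¬ k ≤ i := by omega
            have e2 : ¬ k + 1 ≤ i := by omega
            have e3 : k + 1 + (j - i) = k + (j - i) + 1 := by omega
            simp only [e1, e2, if_false, e3]
            exact hx _ (by omega)
      · refine hmin (i - j) (by omega) ⟨by omega,
          fun k => if k < i - j then x (j + 1 + k) else x (j + 1), ?_, fun k hk => ?_⟩
        · simp
        · simp only [hk, if_true]
          by_cases hk' : k + 1 < i - j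
          · simp only [hk', if_true]
            exact hx (j + 1 + k) (by omega)
          · simp only [hk', if_false]
            have e : j + 1 + k = i := by omega
            rw [e]; exact hlt)
  have hd : ∀ y, dist (g (h y)) (h y) ≤ δ / 2 := fun y => (hg (h y)).trans (by linarith)
  refine iterate_ne_of_fixedPointFree (h := h.trans g) (M := M + δ / 2) ?_ ?_ (x 0) hn ?_
  · intro y
    have h1 := hM y
    have h2 := hd y
    have h3 := dist_triangle (g (h y)) (h y) y
    rw [← dist_eq_norm] at h1 ⊢
    simp only [Homeomorph.trans_apply]
    linarith
  · intro y hy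
    have h1 := hδh y
    have h2 := hd y
    rw [Homeomorph.trans_apply] at hy
    rw [hy, dist_comm] at h2
    linarith
  · have : ∀ k ≤ n, (h.trans g)^[k] (x 0) = x k := by
      intro k
      induction k with
      | zero => intro _; rfl
      | succ k ih =>
        intro hk
        rw [Function.iterate_succ_apply', ih (by omega), Homeomorph.trans_apply]
        exact hgZ ⟨k, by omega⟩
    rw [this n le_rfl, hx0]

/-- Franks lemma for the sup norm on `ℝ × ℝ`. -/
theorem not_closed_chain {G : (ℝ × ℝ) ≃ₜ (ℝ × ℝ)} {M δ : ℝ} (hM : ∀ x, ‖G x - x‖ ≤ M) (hδ : 0 < δ)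
    (hδG : ∀ x, δ ≤ dist (G x) x) (x₀ : ℝ × ℝ) :
    ¬ Relation.TransGen (fun x y => dist (G x) y < δ / 8) x₀ x₀ := by
  let e := Complex.equivRealProdCLM
  have he1 : ∀ z : ℂ, ‖e z‖ ≤ ‖z‖ := fun z =>
    max_le (Complex.abs_re_le_norm z) (Complex.abs_im_le_norm z)
  have he2 : ∀ z : ℂ, ‖z‖ ≤ 2 * ‖e z‖ := by
    intro z
    have h1 : |z.re| ≤ ‖e z‖ := le_max_left _ _
    have h2 : |z.im| ≤ ‖e z‖ := le_max_right _ _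
    linarith [Complex.norm_le_abs_re_add_abs_im z]
  let h : ℂ ≃ₜ ℂ := (e.toHomeomorph.trans G).trans e.toHomeomorph.symm
  have heh : ∀ z, e (h z) = G (e z) := fun z => e.apply_symm_apply _
  intro hch
  refine not_closed_chain_plane (h := h) (M := 2 * M) ?_ hδ ?_ (e.symm x₀)
    (hch.lift e.symm ?_)
  · intro z
    refine (he2 _).trans ?_
    rw [map_sub, heh]
    linarith [hM (e z)]
  · intro z
    refine (hδG (e z)).trans ?_
    rw [dist_eq_norm, dist_eq_norm, ← heh, ← map_sub]
    exact he1 _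
  · intro x y hxy
    have h1 := he2 (h (e.symm x) - e.symm y)
    rw [map_sub, heh, e.apply_symm_apply, e.apply_symm_apply, ← dist_eq_norm, ← dist_eq_norm] at h1
    linarith

/-- An integer vector in the plane. -/
def intVec (m : ℤ × ℤ) : ℝ × ℝ := ((m.1 : ℝ), (m.2 : ℝ))

theorem intVec_zero : intVec 0 = 0 := by simp [intVec]

theorem intVec_add (m n : ℤ × ℤ) : intVec (m + n) = intVec m + intVec n := by simp [intVec]

theorem intVec_neg (m : ℤ × ℤ) : intVec (-m) = -intVec m := by simp [intVec]

theorem intVec_sub (m n : ℤ × ℤ) : intVec (m - n) = intVec m - intVec n := by simp [intVec]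

theorem intVec_nsmul (k : ℕ) (m : ℤ × ℤ) : intVec (k • m) = (k : ℝ) • intVec m := by
  simp [intVec]

theorem torusProj_add (x y : ℝ × ℝ) : torusProj (x + y) = torusProj x + torusProj y := by
  simp [torusProj]

theorem torusProj_intVec (m : ℤ × ℤ) : torusProj (intVec m) = 0 := by
  have : ∀ k : ℤ, ((k : ℝ) : AddCircle (1 : ℝ)) = 0 := fun k =>
    (AddCircle.coe_eq_zero_iff 1).2 ⟨k, by simp⟩
  simp [torusProj, intVec, this]

theorem torusProj_add_intVec (x : ℝ × ℝ) (m : ℤ × ℤ) : torusProj (x + intVec m) = torusProj x := by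
  rw [torusProj_add, torusProj_intVec, add_zero]

theorem exists_intVec_of_torusProj_eq {x y : ℝ × ℝ} (h : torusProj x = torusProj y) :
    ∃ m, y = x + intVec m := by
  simp only [torusProj, Prod.mk.injEq] at h
  have key : ∀ a b : ℝ, (a : AddCircle (1 : ℝ)) = b → ∃ k : ℤ, b = a + k := by
    intro a b hab
    have h2 : ((b - a : ℝ) : AddCircle (1 : ℝ)) = 0 := by rw [AddCircle.coe_sub, hab, sub_self]
    obtain ⟨k, hk⟩ := (AddCircle.coe_eq_zero_iff 1).1 h2
    exact ⟨k, by simp at hk; linarith⟩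
  obtain ⟨k, hk⟩ := key _ _ h.1
  obtain ⟨l, hl⟩ := key _ _ h.2
  exact ⟨(k, l), Prod.ext hk hl⟩

theorem continuous_torusProj : Continuous torusProj :=
  ((AddCircle.continuous_mk' 1).comp continuous_fst).prodMk
    ((AddCircle.continuous_mk' 1).comp continuous_snd)

theorem isOpenMap_torusProj : IsOpenMap torusProj :=
  (QuotientAddGroup.isOpenMap_coe (N := AddSubgroup.zmultiples (1 : ℝ))).prodMap
    (QuotientAddGroup.isOpenMap_coe (N := AddSubgroup.zmultiples (1 : ℝ)))

theorem torusProj_surjective : Function.Surjective torusProj := by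
  rintro ⟨a, b⟩
  obtain ⟨a, rfl⟩ := QuotientAddGroup.mk_surjective a
  obtain ⟨b, rfl⟩ := QuotientAddGroup.mk_surjective b
  exact ⟨(a, b), rfl⟩

theorem IsTorusLift.apply_add_intVec {F : ℝ × ℝ → ℝ × ℝ} (hF : IsTorusLift F) (x : ℝ × ℝ)
    (m : ℤ × ℤ) : F (x + intVec m) = F x + intVec m := hF x m

theorem IsTorusLift.iterate {F : ℝ × ℝ → ℝ × ℝ} (hF : IsTorusLift F) (n : ℕ) :
    IsTorusLift F^[n] := by
  induction n with
  | zero => intro x m; rfl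
  | succ n ih =>
    intro x m
    rw [Function.iterate_succ_apply', Function.iterate_succ_apply', ih x m, hF]

/-- The integer part of a vector, coordinatewise. -/
noncomputable def intFloor (x : ℝ × ℝ) : ℤ × ℤ := (⌊x.1⌋, ⌊x.2⌋)

/-- The closed unit square. -/
def unitSquare : Set (ℝ × ℝ) := Set.Icc 0 1 ×ˢ Set.Icc 0 1

theorem isCompact_unitSquare : IsCompact unitSquare := isCompact_Icc.prod isCompact_Icc

theorem sub_intFloor_mem (x : ℝ × ℝ) : x - intVec (intFloor x) ∈ unitSquare := by
  have h1 := Int.floor_le x.1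
  have h2 := Int.lt_floor_add_one x.1
  have h3 := Int.floor_le x.2
  have h4 := Int.lt_floor_add_one x.2
  refine ⟨⟨?_, ?_⟩, ⟨?_, ?_⟩⟩ <;> simp only [intVec, intFloor, Prod.fst_sub, Prod.snd_sub] <;>
    linarith

theorem exists_eq_add_intVec (x : ℝ × ℝ) : ∃ y ∈ unitSquare, ∃ m, x = y + intVec m :=
  ⟨_, sub_intFloor_mem x, intFloor x, (sub_add_cancel _ _).symm⟩

theorem norm_le_one_of_mem_unitSquare {x : ℝ × ℝ} (hx : x ∈ unitSquare) : ‖x‖ ≤ 1 := by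
  obtain ⟨⟨h1, h2⟩, h3, h4⟩ := hx
  refine max_le ?_ ?_ <;> rw [Real.norm_eq_abs, abs_le] <;> constructor <;> linarith

theorem IsTorusLift.exists_displacement_bound {F : ℝ × ℝ → ℝ × ℝ} (hF : IsTorusLift F)
    (hc : Continuous F) : ∃ M, ∀ x, ‖F x - x‖ ≤ M := by
  obtain ⟨M, hM⟩ := isCompact_unitSquare.exists_bound_of_continuousOn (f := fun x => F x - x)
    (by fun_prop)
  refine ⟨M, fun x => ?_⟩
  obtain ⟨y, hy, m, rfl⟩ := exists_eq_add_intVec x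
  rw [hF.apply_add_intVec, add_sub_add_right_eq_sub]
  exact hM y hy

theorem IsTorusLift.exists_displacement_pos {F : ℝ × ℝ → ℝ × ℝ} (hF : IsTorusLift F)
    (hc : Continuous F) (hfix : ∀ x, F x ≠ x) : ∃ δ > 0, ∀ x, δ ≤ dist (F x) x := by
  obtain ⟨z, -, hz⟩ := isCompact_unitSquare.exists_isMinOn (f := fun x => dist (F x) x)
    ⟨_, sub_intFloor_mem 0⟩ (by fun_prop)
  refine ⟨dist (F z) z, dist_pos.2 (hfix z), fun x => ?_⟩
  obtain ⟨y, hy, m, rfl⟩ := exists_eq_add_intVec x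
  rw [hF.apply_add_intVec, dist_add_right]
  exact isMinOn_iff.1 hz y hy

theorem norm_iterate_sub_le {F : ℝ × ℝ → ℝ × ℝ} {M : ℝ} (hM : ∀ x, ‖F x - x‖ ≤ M) (n : ℕ)
    (x : ℝ × ℝ) : ‖F^[n] x - x‖ ≤ n * M := by
  induction n with
  | zero => simp
  | succ n ih =>
    rw [Function.iterate_succ_apply']
    have h1 := norm_add_le (F (F^[n] x) - F^[n] x) (F^[n] x - x)
    rw [sub_add_sub_cancel] at h1
    have h2 := hM (F^[n] x)
    push_cast
    linarith

/-- Along any sequence of times going to infinity, some subsequence of mean displacements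
converges, to a rotation vector. -/
theorem exists_rotation_limit {F : ℝ × ℝ → ℝ × ℝ} {M : ℝ} (hM : ∀ x, ‖F x - x‖ ≤ M)
    (x : ℕ → ℝ × ℝ) (n : ℕ → ℕ) (hn : Tendsto n atTop atTop) :
    ∃ v ∈ RotSet F, ∃ φ : ℕ → ℕ, StrictMono φ ∧
      Tendsto (fun i => (n (φ i) : ℝ)⁻¹ • (F^[n (φ i)] (x (φ i)) - x (φ i))) atTop (𝓝 v) := by
  have hmem : ∀ i, (n i : ℝ)⁻¹ • (F^[n i] (x i) - x i) ∈ Metric.closedBall (0 : ℝ × ℝ) M := by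
    intro i
    rw [mem_closedBall_zero_iff, norm_smul, norm_inv, Real.norm_natCast]
    have h0 : 0 ≤ M := (norm_nonneg _).trans (hM 0)
    rcases (n i).eq_zero_or_pos with h | h
    · simpa [h] using h0
    · have : (0 : ℝ) < n i := by exact_mod_cast h
      rw [inv_mul_le_iff₀ this]
      exact norm_iterate_sub_le hM _ _
  obtain ⟨v, -, φ, hφ, hv⟩ := (isCompact_closedBall (0 : ℝ × ℝ) M).tendsto_subseq hmem
  exact ⟨v, ⟨x ∘ φ, n ∘ φ, hn.comp hφ.tendsto_atTop, hv⟩, φ, hφ, hv⟩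

/-- `ChainRel G ε x y`: there is an `ε`-chain of `G` with at least one step from `x` to `y`. -/
def ChainRel (G : ℝ × ℝ → ℝ × ℝ) (ε : ℝ) : ℝ × ℝ → ℝ × ℝ → Prop :=
  Relation.TransGen fun x y => dist (G x) y < ε

theorem ChainRel.add_intVec {G : ℝ × ℝ → ℝ × ℝ} (hG : IsTorusLift G) {ε : ℝ} {x y : ℝ × ℝ}
    (h : ChainRel G ε x y) (m : ℤ × ℤ) : ChainRel G ε (x + intVec m) (y + intVec m) :=
  h.lift (fun z => z + intVec m) fun a b hab => by
    simpa only [Function.onFun, hG.apply_add_intVec, dist_add_right] using hab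

theorem chainRel_iterate {G : ℝ × ℝ → ℝ × ℝ} {ε : ℝ} (hε : 0 < ε) (x : ℝ × ℝ) {n : ℕ}
    (hn : 1 ≤ n) : ChainRel G ε x (G^[n] x) := by
  induction n, hn using Nat.le_induction with
  | base => exact Relation.TransGen.single (by simpa using hε)
  | succ n hn ih =>
    refine ih.tail ?_
    rw [Function.iterate_succ_apply', dist_self]; exact hε

theorem isOpen_chainRel_right (G : ℝ × ℝ → ℝ × ℝ) (ε : ℝ) (x : ℝ × ℝ) :
    IsOpen {y | ChainRel G ε x y} := by
  have : {y | ChainRel G ε x y} =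
      ⋃ z ∈ {z | Relation.ReflTransGen (fun x y => dist (G x) y < ε) x z}, Metric.ball (G z) ε := by
    ext y
    simp only [ChainRel, Relation.TransGen.tail'_iff, Set.mem_ofPred_eq, Set.mem_iUnion,
      Metric.mem_ball, exists_prop, dist_comm]
  rw [this]
  exact isOpen_biUnion fun _ _ => Metric.isOpen_ball

theorem isOpen_chainRel_left {G : ℝ × ℝ → ℝ × ℝ} (hG : Continuous G) (ε : ℝ) (y : ℝ × ℝ) :
    IsOpen {x | ChainRel G ε x y} := by
  have : {x | ChainRel G ε x y} =
      ⋃ z ∈ {z | Relation.ReflTransGen (fun x y => dist (G x) y < ε) z y},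
        G ⁻¹' Metric.ball z ε := by
    ext x
    simp only [ChainRel, Relation.TransGen.head'_iff, Set.mem_ofPred_eq, Set.mem_iUnion,
      Metric.mem_ball, exists_prop, Set.mem_preimage, and_comm]
  rw [this]
  exact isOpen_biUnion fun _ _ => Metric.isOpen_ball.preimage hG

/-- Chain transitivity of lifts of area preserving torus homeomorphisms, up to translation. -/
theorem exists_chainRel_add_intVec (f : Torus2 ≃ₜ Torus2) (G : (ℝ × ℝ) ≃ₜ (ℝ × ℝ))
    (hG : IsTorusLift G) (hproj : ∀ x, torusProj (G x) = f (torusProj x))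
    (harea : MeasurePreserving f volume volume) {ε : ℝ} (hε : 0 < ε) (x y : ℝ × ℝ) :
    ∃ m, ChainRel G ε x (y + intVec m) := by
  let A : Set (ℝ × ℝ) := {y | ∃ m, ChainRel G ε x (y + intVec m)}
  have hAo : IsOpen A := by
    have : A = ⋃ m, (fun y => y + intVec m) ⁻¹' {y | ChainRel G ε x y} := by
      ext y; simp [A]
    rw [this]
    exact isOpen_iUnion fun m => (isOpen_chainRel_right G ε x).preimage (by fun_prop)
  have hAstep : ∀ y ∈ A, ∀ z, dist (G y) z < ε → z ∈ A := by
    rintro y ⟨m, hm⟩ z hz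
    refine ⟨m, hm.tail ?_⟩
    rw [hG.apply_add_intVec, dist_add_right]; exact hz
  let U := torusProj '' A
  have hUo : IsOpen U := isOpenMap_torusProj _ hAo
  have hAU : torusProj ⁻¹' U = A := by
    refine Set.Subset.antisymm ?_ (Set.subset_preimage_image _ _)
    rintro z ⟨w, ⟨m, hm⟩, hwz⟩
    obtain ⟨k, rfl⟩ := exists_intVec_of_torusProj_eq hwz
    exact ⟨m - k, by rwa [intVec_sub, add_assoc, add_sub_cancel]⟩
  have hfC : f '' closure U ⊆ U := by
    rintro _ ⟨c, hc, rfl⟩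
    obtain ⟨z, rfl⟩ := torusProj_surjective c
    have hz : z ∈ closure A := by
      rw [← hAU, ← isOpenMap_torusProj.preimage_closure_eq_closure_preimage continuous_torusProj]
      exact hc
    rw [← hproj]
    refine ⟨G z, ?_, rfl⟩
    have := mem_closure_iff.1 hz (G ⁻¹' Metric.ball (G z) ε)
      (Metric.isOpen_ball.preimage G.continuous) (Metric.mem_ball_self hε)
    obtain ⟨w, hw, hwA⟩ := this
    exact hAstep w hwA _ hw
  have hfcl : IsClosed (f '' closure U) := f.isClosedMap _ isClosed_closure
  have hmeas : volume (f '' closure U) = volume (closure U) := by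
    rw [← harea.measure_preimage hfcl.measurableSet.nullMeasurableSet,
      f.injective.preimage_image]
  have hUf : U ⊆ f '' closure U := by
    have hop : IsOpen (U \ f '' closure U) := hUo.sdiff hfcl
    have hz : volume (U \ f '' closure U) = 0 := by
      refine measure_mono_null (Set.sdiff_subset_sdiff_left subset_closure) ?_
      rw [measure_sdiff (hfC.trans subset_closure) hfcl.measurableSet.nullMeasurableSet
        (measure_ne_top _ _), hmeas, tsub_self]
    exact Set.sdiff_eq_empty.1 (hop.eq_empty_of_measure_zero hz)
  have hUcl : IsClosed U := by
    rw [Set.Subset.antisymm hUf hfC]; exact hfcl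
  have hAclopen : IsClopen A := ⟨hAU ▸ hUcl.preimage continuous_torusProj, hAo⟩
  have hAne : A.Nonempty := ⟨G x, 0, by
    rw [intVec_zero, add_zero]; exact chainRel_iterate hε x le_rfl⟩
  have := hAclopen.eq_univ hAne
  exact (this ▸ Set.mem_univ y : y ∈ A)

/-- An additive semigroup of integer vectors missing zero lies in a closed half plane. -/
theorem exists_linear_nonneg_of_zero_notMem {S : Set (ℤ × ℤ)}
    (hadd : ∀ u ∈ S, ∀ v ∈ S, u + v ∈ S) (h0 : (0 : ℤ × ℤ) ∉ S) :
    ∃ α β : ℝ, (α ≠ 0 ∨ β ≠ 0) ∧ ∀ v ∈ S, 0 ≤ α * v.1 + β * v.2 := by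
  rcases S.eq_empty_or_nonempty with rfl | ⟨w, hw⟩
  · exact ⟨1, 0, by simp, by simp⟩
  have hmul : ∀ (k : ℕ) (v : ℤ × ℤ), v ∈ S → ((k + 1 : ℕ)) • v ∈ S := by
    intro k v hv
    induction k with
    | zero => simpa using hv
    | succ k ih => rw [succ_nsmul]; exact hadd _ ih _ hv
  have hw0 : w ≠ 0 := fun h => h0 (h ▸ hw)
  -- determinant and inner product with the base vector
  let D : ℤ × ℤ → ℤ := fun v => w.1 * v.2 - w.2 * v.1
  let I : ℤ × ℤ → ℤ := fun v => w.1 * v.1 + w.2 * v.2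
  have hn : 0 < I w := by
    have : w.1 ≠ 0 ∨ w.2 ≠ 0 := by
      by_contra hne
      push Not at hne
      exact hw0 (Prod.ext hne.1 hne.2)
    rcases this with h | h
    · have := sq_pos_of_ne_zero h; simp only [I]; nlinarith [sq_nonneg w.2]
    · have := sq_pos_of_ne_zero h; simp only [I]; nlinarith [sq_nonneg w.1]
  have hzero : ∀ v : ℤ × ℤ, D v = 0 → I v = 0 → v = 0 := by
    intro v h1 h2
    simp only [D, I] at h1 h2 hn
    have e1 : (w.1 * w.1 + w.2 * w.2) * v.1 = 0 := by linear_combination w.1 * h2 - w.2 * h1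
    have e2 : (w.1 * w.1 + w.2 * w.2) * v.2 = 0 := by linear_combination w.2 * h2 + w.1 * h1
    exact Prod.ext ((mul_eq_zero.1 e1).resolve_left hn.ne') ((mul_eq_zero.1 e2).resolve_left hn.ne')
  have hDadd : ∀ u v, D (u + v) = D u + D v := by intro u v; simp [D]; ring
  have hIadd : ∀ u v, I (u + v) = I u + I v := by intro u v; simp [I]; ring
  have hDs : ∀ (k : ℕ) v, D (k • v) = k * D v := by intro k v; simp [D]; ring
  have hIs : ∀ (k : ℕ) v, I (k • v) = k * I v := by intro k v; simp [I]; ring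
  have hDw : D w = 0 := by simp only [D]; ring
  -- on the line through the base vector the semigroup is positive
  have hline : ∀ v ∈ S, D v = 0 → 0 < I v := by
    intro v hv hD
    by_contra hI
    rw [not_lt] at hI
    rcases hI.eq_or_lt with hI | hI
    · exact h0 (hzero v hD hI ▸ hv)
    · have hk := hmul ((I w).toNat - 1) v hv
      have hl := hmul ((-I v).toNat - 1) w hw
      have e1 : (((I w).toNat - 1 + 1 : ℕ) : ℤ) = I w := by omega
      have e2 : (((-I v).toNat - 1 + 1 : ℕ) : ℤ) = -I v := by omega
      have := hzero (((I w).toNat - 1 + 1) • v + ((-I v).toNat - 1 + 1) • w)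
        (by rw [hDadd, hDs, hDs, hD, hDw]; ring) (by rw [hIadd, hIs, hIs, e1, e2]; ring)
      exact h0 (this ▸ hadd _ hk _ hl)
  have hpair : ∀ a ∈ S, ∀ b ∈ S, D a < 0 → 0 < D b → 0 < I a * D b - I b * D a := by
    intro a ha b hb hDa hDb
    have hk := hmul ((D b).toNat - 1) a ha
    have hl := hmul ((-D a).toNat - 1) b hb
    have e1 : (((D b).toNat - 1 + 1 : ℕ) : ℤ) = D b := by omega
    have e2 : (((-D a).toNat - 1 + 1 : ℕ) : ℤ) = -D a := by omega
    have := hline _ (hadd _ hk _ hl) (by rw [hDadd, hDs, hDs, e1, e2]; ring)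
    rw [hIadd, hIs, hIs, e1, e2] at this
    linarith
  by_cases hA : ∃ a ∈ S, D a < 0
  · by_cases hB : ∃ b ∈ S, 0 < D b
    · obtain ⟨a₀, ha₀, hDa₀⟩ := hA
      obtain ⟨b₀, hb₀, hDb₀⟩ := hB
      let T : Set ℝ := {s | ∃ a ∈ S, D a < 0 ∧ s = (I a : ℝ) / D a}
      have hle : ∀ s ∈ T, ∀ b ∈ S, 0 < D b → s ≤ (I b : ℝ) / D b := by
        rintro _ ⟨a, ha, hDa, rfl⟩ b hb hDb
        have h1 : (0 : ℝ) < I a * D b - I b * D a := by exact_mod_cast hpair a ha b hb hDa hDb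
        have h2 : (D a : ℝ) < 0 := by exact_mod_cast hDa
        have h3 : (0 : ℝ) < D b := by exact_mod_cast hDb
        rw [div_le_iff_of_neg h2, div_mul_eq_mul_div, div_le_iff₀ h3]
        linarith
      have hne : T.Nonempty := ⟨_, a₀, ha₀, hDa₀, rfl⟩
      have hbdd : BddAbove T := ⟨_, fun s hs => hle s hs b₀ hb₀ hDb₀⟩
      let σ := sSup T
      have hform : ∀ v : ℤ × ℤ, (w.1 + σ * w.2) * v.1 + (w.2 - σ * w.1) * v.2
          = (I v : ℝ) - σ * D v := by
        intro v; simp only [I, D]; push_cast; ring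
      refine ⟨w.1 + σ * w.2, w.2 - σ * w.1, ?_, fun v hv => ?_⟩
      · by_contra hcon
        push Not at hcon
        have := hform w
        rw [hcon.1, hcon.2, hDw] at this
        have h2 : (0 : ℝ) < I w := by exact_mod_cast hn
        simp at this
        linarith
      · rw [hform]
        rcases lt_trichotomy (D v) 0 with h | h | h
        · have h2 : (D v : ℝ) < 0 := by exact_mod_cast h
          have h3 : (I v : ℝ) / D v ≤ σ := le_csSup hbdd ⟨v, hv, h, rfl⟩
          rw [div_le_iff_of_neg h2] at h3
          linarith
        · rw [h]
          have : (0 : ℝ) < I v := by exact_mod_cast hline v hv h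
          rw [Int.cast_zero, mul_zero, sub_zero]; exact this.le
        · have h2 : (0 : ℝ) < D v := by exact_mod_cast h
          have h3 : σ ≤ (I v : ℝ) / D v := csSup_le hne fun s hs => hle s hs v hv h
          rw [le_div_iff₀ h2] at h3
          linarith
    · push Not at hB
      refine ⟨w.2, -w.1, ?_, fun v hv => ?_⟩
      · by_contra hcon
        push Not at hcon
        exact hw0 (Prod.ext (by simpa using hcon.2) (by simpa using hcon.1))
      · have : (D v : ℝ) ≤ 0 := by exact_mod_cast hB v hv
        simp only [D] at this; push_cast at this
        linarith
  · push Not at hA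
    refine ⟨-w.2, w.1, ?_, fun v hv => ?_⟩
    · by_contra hcon
      push Not at hcon
      exact hw0 (Prod.ext (by simpa using hcon.2) (by simpa using hcon.1))
    · have : (0 : ℝ) ≤ D v := by exact_mod_cast hA v hv
      simp only [D] at this; push_cast at this
      linarith

theorem IsCompact.exists_bounded_index {X ι : Type*} [TopologicalSpace X] {K : Set X}
    (hK : IsCompact K) {U : ι → Set X} (hU : ∀ i, IsOpen (U i)) (hcov : ∀ x, ∃ i, x ∈ U i)
    (c : ι → ℝ) : ∃ C, ∀ x ∈ K, ∃ i, x ∈ U i ∧ |c i| ≤ C := by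
  obtain ⟨t, ht⟩ := hK.elim_finite_subcover U hU fun x _ => Set.mem_iUnion.2 (hcov x)
  refine ⟨∑ i ∈ t, |c i|, fun x hx => ?_⟩
  obtain ⟨i, hi, hxi⟩ := Set.mem_iUnion₂.1 (ht hx)
  exact ⟨i, hxi, Finset.single_le_sum (f := fun i => |c i|) (fun _ _ => abs_nonneg _) hi⟩

/-- If a functional is nonnegative on all chain translations of a point, then it is
bounded below along all chains. -/
theorem exists_chain_lower_bound {G : ℝ × ℝ → ℝ × ℝ} (hG : IsTorusLift G) (hc : Continuous G)
    {ε : ℝ} (htrans : ∀ x y, ∃ m, ChainRel G ε x (y + intVec m)) (L : ℝ × ℝ →L[ℝ] ℝ) (x₀ : ℝ × ℝ)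
    (hL : ∀ v, ChainRel G ε x₀ (x₀ + intVec v) → 0 ≤ L (intVec v)) :
    ∃ C, ∀ x y, ChainRel G ε x y → -C ≤ L (y - x) := by
  obtain ⟨C₁, hC₁⟩ := isCompact_unitSquare.exists_bounded_index
    (U := fun v => {x | ChainRel G ε x₀ (x + intVec v)})
    (fun v => (isOpen_chainRel_right G ε x₀).preimage (by fun_prop)) (fun x => htrans x₀ x)
    (fun v => L (intVec v))
  obtain ⟨C₂, hC₂⟩ := isCompact_unitSquare.exists_bounded_index
    (U := fun v => {y | ChainRel G ε y (x₀ + intVec v)})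
    (fun v => isOpen_chainRel_left hc ε _) (fun y => htrans y x₀)
    (fun v => L (intVec v))
  refine ⟨C₁ + C₂ + 2 * ‖L‖, fun x y hxy => ?_⟩
  obtain ⟨x', hx', m, rfl⟩ := exists_eq_add_intVec x
  obtain ⟨y', hy', n, rfl⟩ := exists_eq_add_intVec y
  obtain ⟨v, hv, hvC⟩ := hC₁ x' hx'
  obtain ⟨w, hw, hwC⟩ := hC₂ y' hy'
  have h1 : ChainRel G ε x₀ (x₀ + intVec (w + (n - m) + v)) := by
    have h2 := hxy.add_intVec hG (v - m)
    have h3 : ChainRel G ε _ _ := hw.add_intVec hG (n + (v - m))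
    have e1 : x' + intVec m + intVec (v - m) = x' + intVec v := by rw [intVec_sub]; abel
    have e2 : y' + intVec n + intVec (v - m) = y' + intVec (n + (v - m)) := by
      rw [intVec_add n]; abel
    have e3 : x₀ + intVec w + intVec (n + (v - m)) = x₀ + intVec (w + (n - m) + v) := by
      rw [add_assoc, ← intVec_add]; congr 2; abel
    rw [e1, e2] at h2
    rw [e3] at h3
    exact (Relation.TransGen.trans hv h2).trans h3
  have h2 := hL _ h1
  rw [intVec_add, intVec_add, intVec_sub, map_add, map_add, map_sub] at h2
  have h3 : ∀ z ∈ unitSquare, |L z| ≤ ‖L‖ := by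
    intro z hz
    have := L.le_opNorm z
    rw [Real.norm_eq_abs] at this
    exact this.trans (mul_le_of_le_one_right (norm_nonneg _) (norm_le_one_of_mem_unitSquare hz))
  have h4 := abs_le.1 (h3 x' hx')
  have h5 := abs_le.1 (h3 y' hy')
  have h6 := abs_le.1 hvC
  have h7 := abs_le.1 hwC
  rw [map_sub, map_add, map_add]
  linarith

/-- A measurable section of the torus projection. -/
noncomputable def torusSection (t : Torus2) : ℝ × ℝ :=
  (AddCircle.measurableEquivIoc 1 0 t.1, AddCircle.measurableEquivIoc 1 0 t.2)

theorem measurable_torusSection : Measurable torusSection :=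
  (measurable_subtype_coe.comp ((AddCircle.measurableEquivIoc 1 0).measurable.comp
    measurable_fst)).prodMk (measurable_subtype_coe.comp
      ((AddCircle.measurableEquivIoc 1 0).measurable.comp measurable_snd))

theorem torusProj_torusSection (t : Torus2) : torusProj (torusSection t) = t :=
  Prod.ext AddCircle.coe_equivIoc AddCircle.coe_equivIoc

theorem eq_torusSection_add_intVec (x : ℝ × ℝ) :
    ∃ m, x = torusSection (torusProj x) + intVec m :=
  exists_intVec_of_torusProj_eq (torusProj_torusSection _)

instance isProbabilityMeasure_torus : IsProbabilityMeasure (volume : Measure Torus2) := by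
  have h : IsProbabilityMeasure (volume : Measure (AddCircle (1 : ℝ))) :=
    ⟨by rw [AddCircle.measure_univ]; simp⟩
  rw [Measure.volume_eq_prod]
  infer_instance

instance isAddRightInvariant_torus : (volume : Measure Torus2).IsAddRightInvariant := by
  rw [Measure.volume_eq_prod]
  infer_instance

/-- The infimum of a functional over all points reachable by chains. -/
noncomputable def chainInf (G : ℝ × ℝ → ℝ × ℝ) (ε : ℝ) (L : ℝ × ℝ →L[ℝ] ℝ) (x : ℝ × ℝ) : ℝ :=
  sInf (L '' {y | ChainRel G ε x y})

section ChainInf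

variable {G : ℝ × ℝ → ℝ × ℝ} {ε C : ℝ} {L : ℝ × ℝ →L[ℝ] ℝ}

theorem nonempty_image_chainRel (hε : 0 < ε) (x : ℝ × ℝ) :
    (L '' {y | ChainRel G ε x y}).Nonempty :=
  ⟨_, G x, chainRel_iterate hε x le_rfl, rfl⟩

theorem mem_lowerBounds_image_chainRel (hC : ∀ x y, ChainRel G ε x y → -C ≤ L (y - x))
    (x : ℝ × ℝ) : L x - C ∈ lowerBounds (L '' {y | ChainRel G ε x y}) := by
  rintro _ ⟨y, hy, rfl⟩
  have := hC x y hy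
  rw [map_sub] at this
  linarith

theorem chainInf_le (hC : ∀ x y, ChainRel G ε x y → -C ≤ L (y - x)) {x y : ℝ × ℝ}
    (h : ChainRel G ε x y) : chainInf G ε L x ≤ L y :=
  csInf_le ⟨_, mem_lowerBounds_image_chainRel hC x⟩ ⟨y, h, rfl⟩

theorem le_chainInf (hε : 0 < ε) (hC : ∀ x y, ChainRel G ε x y → -C ≤ L (y - x)) (x : ℝ × ℝ) :
    L x - C ≤ chainInf G ε L x :=
  le_csInf (nonempty_image_chainRel hε x) (mem_lowerBounds_image_chainRel hC x)

theorem exists_lt_of_chainInf_lt (hε : 0 < ε) {x : ℝ × ℝ} {c : ℝ} (h : chainInf G ε L x < c) :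
    ∃ y, ChainRel G ε x y ∧ L y < c := by
  obtain ⟨_, ⟨y, hy, rfl⟩, hlt⟩ := exists_lt_of_csInf_lt (nonempty_image_chainRel hε x) h
  exact ⟨y, hy, hlt⟩

theorem chainInf_mono (hε : 0 < ε) (hC : ∀ x y, ChainRel G ε x y → -C ≤ L (y - x)) {x y : ℝ × ℝ}
    (h : ChainRel G ε x y) : chainInf G ε L x ≤ chainInf G ε L y :=
  le_csInf (nonempty_image_chainRel hε y) (by
    rintro _ ⟨z, hz, rfl⟩
    exact chainInf_le hC (Relation.TransGen.trans h hz))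

theorem chainInf_add_intVec (hG : IsTorusLift G) (hε : 0 < ε)
    (hC : ∀ x y, ChainRel G ε x y → -C ≤ L (y - x)) (x : ℝ × ℝ) (m : ℤ × ℤ) :
    chainInf G ε L (x + intVec m) = chainInf G ε L x + L (intVec m) := by
  have key : ∀ (x : ℝ × ℝ) (m : ℤ × ℤ),
      chainInf G ε L (x + intVec m) ≤ chainInf G ε L x + L (intVec m) := by
    intro x m
    refine le_of_forall_gt fun c hc => ?_
    obtain ⟨y, hy, hyc⟩ := exists_lt_of_chainInf_lt (c := c - L (intVec m)) hε (by linarith)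
    have := chainInf_le hC (hy.add_intVec hG m)
    rw [map_add] at this
    linarith
  refine le_antisymm (key x m) ?_
  have := key (x + intVec m) (-m)
  rw [intVec_neg, add_neg_cancel_right, map_neg] at this
  linarith

theorem measurable_chainInf (hc : Continuous G) (hε : 0 < ε)
    (hC : ∀ x y, ChainRel G ε x y → -C ≤ L (y - x)) : Measurable (chainInf G ε L) := by
  refine UpperSemicontinuous.measurable fun x c hx => ?_
  obtain ⟨y, hy, hyc⟩ := exists_lt_of_chainInf_lt hε hx
  filter_upwards [(isOpen_chainRel_left hc ε y).mem_nhds hy] with z hz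
  exact (chainInf_le hC hz).trans_lt hyc

end ChainInf

theorem eq_zero_of_apply_basis {L : ℝ × ℝ →L[ℝ] ℝ} (h1 : L (intVec (1, 0)) = 0)
    (h2 : L (intVec (0, 1)) = 0) : L = 0 := by
  simp only [intVec, Int.cast_one, Int.cast_zero] at h1 h2
  ext
  · simpa using h1
  · simpa using h2

/-- The mean displacement in the direction of a functional bounded below along chains is
positive. -/
theorem integral_displacement_pos (f : Torus2 ≃ₜ Torus2) (G : (ℝ × ℝ) ≃ₜ (ℝ × ℝ))
    (hG : IsTorusLift G) (hproj : ∀ x, torusProj (G x) = f (torusProj x))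
    (harea : MeasurePreserving f volume volume) {M : ℝ} (hM : ∀ x, ‖G x - x‖ ≤ M)
    {ε C : ℝ} (hε : 0 < ε) {L : ℝ × ℝ →L[ℝ] ℝ} (hL : L ≠ 0)
    (hC : ∀ x y, ChainRel G ε x y → -C ≤ L (y - x)) :
    0 < ∫ t, L (G (torusSection t) - torusSection t) := by
  set P := chainInf G ε L with hP
  have hPm : Measurable P := measurable_chainInf G.continuous hε hC
  have hPadd := fun x m => chainInf_add_intVec hG hε hC x m
  rw [← hP] at hPadd
  have hGs := G.continuous.measurable.comp measurable_torusSection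
  have hψm : Measurable fun t => L (G (torusSection t) - torusSection t) :=
    L.continuous.measurable.comp (hGs.sub measurable_torusSection)
  have hdisp : ∀ x, |L (G x - x)| ≤ ‖L‖ * M := fun x =>
    (L.le_opNorm _).trans (mul_le_mul_of_nonneg_left (hM x) (norm_nonneg _))
  have hψi : Integrable fun t => L (G (torusSection t) - torusSection t) :=
    Integrable.of_bound hψm.aestronglyMeasurable (‖L‖ * M) (Eventually.of_forall fun t => hdisp _)
  let u : Torus2 → ℝ := fun t => P (torusSection t) - L (torusSection t)
  have hu : ∀ x, u (torusProj x) = P x - L x := by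
    intro x
    obtain ⟨m, hm⟩ := eq_torusSection_add_intVec x
    conv_rhs => rw [hm]
    rw [hPadd, map_add]
    simp only [u]; ring
  have hum : Measurable u := (hPm.comp measurable_torusSection).sub
    (L.continuous.measurable.comp measurable_torusSection)
  have hub : ∀ t, ‖u t‖ ≤ |C| + ‖L‖ * M := by
    intro t
    have h1 := le_chainInf hε hC (torusSection t)
    have h2 := chainInf_le hC (chainRel_iterate (G := G) hε (torusSection t) le_rfl)
    have h3 := abs_le.1 (hdisp (torusSection t))
    rw [map_sub] at h3
    rw [Function.iterate_one] at h2
    have h4 := neg_abs_le C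
    have h5 := le_abs_self C
    rw [Real.norm_eq_abs, abs_le]
    simp only [u, hP]
    constructor <;> linarith [abs_nonneg C, abs_nonneg (L (G (torusSection t) - torusSection t)),
      hdisp (torusSection t)]
  have hui : Integrable u :=
    Integrable.of_bound hum.aestronglyMeasurable _ (Eventually.of_forall hub)
  have hufi : Integrable (fun t => u (f t)) := harea.integrable_comp_of_integrable hui
  let W : Torus2 → ℝ := fun t => u (f t) - u t + L (G (torusSection t) - torusSection t)
  have hWP : ∀ t, W t = P (G (torusSection t)) - P (torusSection t) := by
    intro t
    have h1 := hu (G (torusSection t))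
    rw [hproj, torusProj_torusSection] at h1
    simp only [W, h1, map_sub]
    simp only [u]; ring
  have hW0 : 0 ≤ W := by
    intro t
    rw [hWP]
    exact sub_nonneg.2 (chainInf_mono hε hC (chainRel_iterate (n := 1) hε _ le_rfl))
  have hWi : Integrable W := (hufi.sub hui).add hψi
  have hint : ∫ t, W t = ∫ t, L (G (torusSection t) - torusSection t) := by
    have h1 : ∫ t, u (f t) = ∫ t, u t := harea.integral_comp f.measurableEmbedding u
    have h2 : ∫ t, W t =
        (∫ t, (u (f t) - u t)) + ∫ t, L (G (torusSection t) - torusSection t) :=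
      integral_add (hufi.sub hui) hψi
    rw [h2, integral_sub hufi hui, h1]
    simp
  rw [← hint]
  refine lt_of_le_of_ne (integral_nonneg hW0) fun h0 => hL ?_
  have hae := (integral_eq_zero_iff_of_nonneg hW0 hWi).1 h0.symm
  have hlift : ∀ x, W (torusProj x) = 0 → P (G x) = P x := by
    intro x hx
    obtain ⟨m, hm⟩ := eq_torusSection_add_intVec x
    rw [hWP] at hx
    rw [hm, hG.apply_add_intVec, hPadd, hPadd]
    linarith
  have hae2 : ∀ᵐ t, W (f.symm t) = 0 :=
    (MeasurePreserving.symm f.toMeasurableEquiv harea).quasiMeasurePreserving.ae hae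
  obtain ⟨N, hN⟩ := exists_nat_one_div_lt hε
  have hae3 : ∀ᵐ t, ∀ (k : ℕ) (i : Bool),
      W (f.symm (t + torusProj ((k / (N + 1) : ℝ) • intVec (if i then (1, 0) else (0, 1))))) = 0 := by
    rw [ae_all_iff]; intro k
    rw [ae_all_iff]; intro i
    exact (measurePreserving_add_right (volume : Measure Torus2) _).quasiMeasurePreserving.ae hae2
  obtain ⟨t, ht⟩ := hae3.exists
  have hbasis : ∀ i : Bool, L (intVec (if i then (1, 0) else (0, 1))) = 0 := by
    intro i
    let z : ℕ → ℝ × ℝ := fun k =>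
      torusSection t + (k / (N + 1) : ℝ) • intVec (if i then (1, 0) else (0, 1))
    have hz : ∀ k y, dist (z k) y < ε → P (z k) ≤ P y := by
      intro k y hy
      have h1 : torusProj (G.symm (z k)) = f.symm (torusProj (z k)) := by
        rw [f.eq_symm_apply, ← hproj, G.apply_symm_apply]
      have h2 := hlift (G.symm (z k)) (by
        rw [h1, torusProj_add, torusProj_torusSection]; exact ht k i)
      rw [G.apply_symm_apply] at h2
      rw [h2]
      refine chainInf_mono hε hC (Relation.TransGen.single ?_)
      rwa [G.apply_symm_apply]
    have hdist : ∀ k, dist (z k) (z (k + 1)) < ε := by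
      intro k
      have e : z k - z (k + 1) = (-(1 / (N + 1) : ℝ)) • intVec (if i then (1, 0) else (0, 1)) := by
        simp only [z]
        rw [add_sub_add_left_eq_sub, ← sub_smul]
        congr 1
        push_cast; ring
      rw [dist_eq_norm, e, norm_smul, norm_neg, Real.norm_of_nonneg (by positivity)]
      have : ‖intVec (if i then (1, 0) else (0, 1))‖ = 1 := by
        cases i <;> simp [intVec, Prod.norm_def]
      rw [this, mul_one]; exact hN
    have hconst : ∀ k, P (z k) = P (z 0) := by
      intro k
      induction k with
      | zero => rfl
      | succ k ih =>
        rw [← ih]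
        exact le_antisymm (hz (k + 1) _ (by rw [dist_comm]; exact hdist k)) (hz k _ (hdist k))
    have h1 := hconst (N + 1)
    have e1 : z (N + 1) = torusSection t + intVec (if i then (1, 0) else (0, 1)) := by
      simp only [z]
      push_cast
      rw [div_self (by positivity), one_smul]
    have e0 : z 0 = torusSection t := by simp [z]
    rw [e1, e0, hPadd] at h1
    linarith
  exact eq_zero_of_apply_basis (hbasis true) (hbasis false)

/-- Some rotation vector is positive on any functional with positive mean displacement. -/
theorem exists_mem_rotSet_pos (f : Torus2 ≃ₜ Torus2) (G : (ℝ × ℝ) ≃ₜ (ℝ × ℝ))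
    (hG : IsTorusLift G) (hproj : ∀ x, torusProj (G x) = f (torusProj x))
    (harea : MeasurePreserving f volume volume) {M : ℝ} (hM : ∀ x, ‖G x - x‖ ≤ M)
    {L : ℝ × ℝ →L[ℝ] ℝ} (hpos : 0 < ∫ t, L (G (torusSection t) - torusSection t)) :
    ∃ v ∈ RotSet G, 0 < L v := by
  let ψ : Torus2 → ℝ := fun t => L (G (torusSection t) - torusSection t)
  have hψ : ∀ x, ψ (torusProj x) = L (G x - x) := by
    intro x
    obtain ⟨m, hm⟩ := eq_torusSection_add_intVec x
    conv_rhs => rw [hm]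
    rw [hG.apply_add_intVec, add_sub_add_right_eq_sub]
  have hψm : Measurable ψ := L.continuous.measurable.comp
    ((G.continuous.measurable.comp measurable_torusSection).sub measurable_torusSection)
  have hψi : Integrable ψ :=
    Integrable.of_bound hψm.aestronglyMeasurable (‖L‖ * M) (Eventually.of_forall fun t =>
      (L.le_opNorm _).trans (mul_le_mul_of_nonneg_left (hM _) (norm_nonneg _)))
  have hiter : ∀ (k : ℕ) x, torusProj (G^[k] x) = f^[k] (torusProj x) := by
    intro k x
    induction k with
    | zero => rfl
    | succ k ih => rw [Function.iterate_succ_apply', Function.iterate_succ_apply', hproj, ih]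
  have hfk : ∀ k : ℕ, MeasurePreserving f^[k] volume volume := fun k => harea.iterate k
  have hembk : ∀ k : ℕ, MeasurableEmbedding (f^[k]) := by
    intro k
    induction k with
    | zero => exact MeasurableEmbedding.id
    | succ k ih => exact ih.comp f.measurableEmbedding
  have hex : ∀ n : ℕ, ∃ x, n * ∫ t, ψ t ≤ L (G^[n] x - x) := by
    intro n
    have hki : ∀ k ∈ Finset.range n, Integrable fun t => ψ (f^[k] t) := fun k _ =>
      (hfk k).integrable_comp_of_integrable hψi
    obtain ⟨t, ht⟩ := exists_integral_le (integrable_finsetSum _ hki)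
    rw [integral_finsetSum _ hki] at ht
    simp only [fun k => (hfk k).integral_comp (hembk k) ψ, Finset.sum_const, Finset.card_range,
      nsmul_eq_mul] at ht
    refine ⟨torusSection t, ht.trans (le_of_eq ?_)⟩
    have e : ∀ k ∈ Finset.range n, ψ (f^[k] t) =
        L (G^[k + 1] (torusSection t)) - L (G^[k] (torusSection t)) := by
      intro k _
      rw [← map_sub, Function.iterate_succ_apply', ← hψ, hiter, torusProj_torusSection]
    rw [Finset.sum_congr rfl e, Finset.sum_range_sub (fun k => L (G^[k] (torusSection t))), map_sub]
    rfl
  choose x hx using hex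
  obtain ⟨v, hv, φ, hφ, hlim⟩ := exists_rotation_limit hM x id tendsto_id
  refine ⟨v, hv, hpos.trans_le ?_⟩
  refine ge_of_tendsto ((L.continuous.tendsto v).comp hlim) ?_
  filter_upwards [hφ.tendsto_atTop.eventually_ge_atTop 1] with i hi
  have h1 : (0 : ℝ) < φ i := by exact_mod_cast hi
  simp only [Function.comp_apply, id, map_smul, smul_eq_mul]
  rw [le_inv_mul_iff₀ h1]
  exact hx (φ i)

theorem IsTorusLift.iterate_sub_intVec {F : ℝ × ℝ → ℝ × ℝ} (hF : IsTorusLift F) (n : ℕ) (x : ℝ × ℝ)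
    (m : ℤ × ℤ) : F^[n] (x - intVec m) = F^[n] x - intVec m := by
  have := (hF.iterate n).apply_add_intVec x (-m)
  rwa [intVec_neg, ← sub_eq_add_neg, ← sub_eq_add_neg] at this

theorem chainRel_of_dist_iterate_lt {G : ℝ × ℝ → ℝ × ℝ} {ε : ℝ} (hε : 0 < ε) {x w : ℝ × ℝ} {k : ℕ}
    (hk : 1 ≤ k) (h : dist (G^[k] x) w < ε) : ChainRel G ε x w := by
  obtain ⟨k, rfl⟩ : ∃ j, k = j + 1 := ⟨k - 1, by omega⟩
  rw [Function.iterate_succ_apply'] at h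
  rcases k.eq_zero_or_pos with rfl | hk
  · exact Relation.TransGen.single h
  · exact (chainRel_iterate hε x hk).tail h

theorem abs_apply_iterate_sub_le {G : ℝ × ℝ → ℝ × ℝ} {M : ℝ} (hM : ∀ x, ‖G x - x‖ ≤ M)
    (L : ℝ × ℝ →L[ℝ] ℝ) (n : ℕ) (x : ℝ × ℝ) : |L (G^[n] x - x)| ≤ ‖L‖ * M * n := by
  refine (L.le_opNorm _).trans ?_
  rw [mul_assoc, mul_comm M]
  exact mul_le_mul_of_nonneg_left (norm_iterate_sub_le hM n x) (norm_nonneg _)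

/-- Displacement is sublinear in directions that vanish on the rotation set. -/
theorem exists_sublinear_bound {G : ℝ × ℝ → ℝ × ℝ} {M : ℝ} (hM : ∀ x, ‖G x - x‖ ≤ M)
    {K : ℝ × ℝ →L[ℝ] ℝ} (hK : ∀ v ∈ RotSet G, K v = 0) {η : ℝ} (hη : 0 < η) :
    ∃ C, ∀ n x, |K (G^[n] x - x)| ≤ η * n + C := by
  by_contra hcon
  push Not at hcon
  choose n x hnx using fun i : ℕ => hcon i
  have hM0 : 0 ≤ M := (norm_nonneg _).trans (hM 0)
  have hD : 0 < ‖K‖ * M + 1 := by positivity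
  have hn : Tendsto n atTop atTop := by
    rw [← tendsto_natCast_atTop_iff (R := ℝ)]
    refine tendsto_atTop_mono (f := fun i : ℕ => (i : ℝ) / (‖K‖ * M + 1)) (fun i => ?_)
      (tendsto_natCast_atTop_atTop.atTop_div_const hD)
    have h1 := hnx i
    have h2 := abs_apply_iterate_sub_le hM K (n i) (x i)
    have h3 : (0 : ℝ) ≤ n i := Nat.cast_nonneg _
    rw [div_le_iff₀ hD]
    nlinarith
  obtain ⟨v, hv, φ, hφ, hlim⟩ := exists_rotation_limit hM x n hn
  have hlimK := ((K.continuous.tendsto v).comp hlim).abs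
  rw [hK v hv, abs_zero] at hlimK
  refine hη.not_ge (ge_of_tendsto hlimK ?_)
  filter_upwards [(hn.comp hφ.tendsto_atTop).eventually_ge_atTop 1] with i hi
  have h1 : (0 : ℝ) < n (φ i) := by exact_mod_cast hi
  simp only [Function.comp_apply, map_smul, smul_eq_mul]
  rw [abs_mul, abs_of_pos (inv_pos.2 h1), le_inv_mul_iff₀ h1]
  have := hnx (φ i)
  have h2 : (0 : ℝ) ≤ φ i := Nat.cast_nonneg _
  linarith

theorem exists_pos_le_of_bounded (L : ℝ × ℝ →L[ℝ] ℝ) (B : ℝ) :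
    ∃ c > 0, ∀ v, ‖intVec v‖ ≤ B → 0 < L (intVec v) → c ≤ L (intVec v) := by
  have hfin : {v : ℤ × ℤ | ‖intVec v‖ ≤ B ∧ 0 < L (intVec v)}.Finite := by
    refine ((Set.finite_Icc (-⌈B⌉) ⌈B⌉).prod (Set.finite_Icc (-⌈B⌉) ⌈B⌉)).subset ?_
    rintro v ⟨hv, -⟩
    have h1 : |(v.1 : ℝ)| ≤ ⌈B⌉ := ((le_max_left _ _).trans hv).trans (Int.le_ceil B)
    have h2 : |(v.2 : ℝ)| ≤ ⌈B⌉ := ((le_max_right _ _).trans hv).trans (Int.le_ceil B)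
    exact ⟨abs_le.1 (by exact_mod_cast h1), abs_le.1 (by exact_mod_cast h2)⟩
  rcases Set.eq_empty_or_nonempty {v : ℤ × ℤ | ‖intVec v‖ ≤ B ∧ 0 < L (intVec v)} with h | h
  · refine ⟨1, one_pos, fun v h1 h2 => ?_⟩
    have : v ∈ {v : ℤ × ℤ | ‖intVec v‖ ≤ B ∧ 0 < L (intVec v)} := ⟨h1, h2⟩
    rw [h] at this
    exact this.elim
  · obtain ⟨w, hw, hmin⟩ := Set.exists_min_image _ (fun v => L (intVec v)) hfin h
    exact ⟨L (intVec w), hw.2, fun v h1 h2 => hmin v ⟨h1, h2⟩⟩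

/-- If every orbit segment of length `N` has a close return with positive translation,
then orbits drift in the positive direction, and zero is not a rotation vector. -/
theorem exists_orbit_without_positive_returns {G : ℝ × ℝ → ℝ × ℝ} (hG : IsTorusLift G) {M : ℝ}
    (hM : ∀ x, ‖G x - x‖ ≤ M) {ε C : ℝ} (hε : 0 < ε) {L : ℝ × ℝ →L[ℝ] ℝ}
    (hC : ∀ x y, ChainRel G ε x y → -C ≤ L (y - x)) (h0 : (0 : ℝ × ℝ) ∈ RotSet G) (N : ℕ) :
    ∃ y, ∀ a b v, 1 ≤ a → a < b → b ≤ N → dist (G^[b] y) (G^[a] y + intVec v) < ε →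
      L (intVec v) ≤ 0 := by
  by_contra hcon
  push Not at hcon
  have hM0 : 0 ≤ M := (norm_nonneg _).trans (hM 0)
  have hN : (0 : ℝ) < N := by
    obtain ⟨a, b, v, h1, h2, h3, -⟩ := hcon 0
    exact_mod_cast (by omega : 0 < N)
  obtain ⟨c, hc, hcv⟩ := exists_pos_le_of_bounded L (ε + N * M)
  have hstep : ∀ y, ∃ v, ChainRel G ε y (G^[N] y - intVec v) ∧ c ≤ L (intVec v) := by
    intro y
    obtain ⟨a, b, v, h1, h2, h3, hd, hpos⟩ := hcon y
    refine ⟨v, ?_, hcv v ?_ hpos⟩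
    · have hab : ChainRel G ε y (G^[b] y - intVec v) := by
        refine chainRel_of_dist_iterate_lt hε h1 ?_
        rwa [dist_comm, ← dist_add_right _ _ (intVec v), sub_add_cancel]
      rcases h3.eq_or_lt with rfl | h3
      · exact hab
      · have := chainRel_iterate (G := G) hε (G^[b] y - intVec v) (n := N - b) (by omega)
        rw [hG.iterate_sub_intVec, ← Function.iterate_add_apply, Nat.sub_add_cancel h3.le] at this
        exact Relation.TransGen.trans hab this
    · have e : G^[b] y = G^[b - a] (G^[a] y) := by
        rw [← Function.iterate_add_apply, Nat.sub_add_cancel h2.le]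
      have h4 := norm_iterate_sub_le hM (b - a) (G^[a] y)
      have h5 : ((b - a : ℕ) : ℝ) ≤ N := by exact_mod_cast (by omega : b - a ≤ N)
      have h6 := mul_le_mul_of_nonneg_right h5 hM0
      rw [← e] at h4
      rw [dist_eq_norm, ← norm_neg] at hd
      have h7 := norm_add_le (-(G^[b] y - (G^[a] y + intVec v))) (G^[b] y - G^[a] y)
      have e2 : -(G^[b] y - (G^[a] y + intVec v)) + (G^[b] y - G^[a] y) = intVec v := by abel
      rw [e2] at h7
      linarith
  have hiter : ∀ (j : ℕ) y, ∃ w, ChainRel G ε y (G^[(j + 1) * N] y - intVec w) ∧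
      c * (j + 1) ≤ L (intVec w) := by
    intro j y
    induction j with
    | zero => simpa using hstep y
    | succ j ih =>
      obtain ⟨w, hw, hwc⟩ := ih
      obtain ⟨v, hv, hvc⟩ := hstep (G^[(j + 1) * N] y)
      refine ⟨v + w, ?_, ?_⟩
      · have := hv.add_intVec hG (-w)
        rw [intVec_neg, ← sub_eq_add_neg, ← sub_eq_add_neg, sub_sub, ← intVec_add,
          ← Function.iterate_add_apply] at this
        have e : (j + 1 + 1) * N = N + (j + 1) * N := by ring
        rw [e]
        exact Relation.TransGen.trans hw this
      · rw [intVec_add, map_add]; push_cast; linarith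
  have hdrift : ∀ (j : ℕ) y, c * j - |C| ≤ L (G^[j * N] y - y) := by
    intro j y
    rcases j with _ | j
    · simp
    · obtain ⟨w, hw, hwc⟩ := hiter j y
      have h1 := hC _ _ hw
      rw [sub_right_comm, map_sub] at h1
      have := le_abs_self C
      push_cast
      linarith
  have hgrow : ∀ (n : ℕ) y, c / N * n - (c + |C| + ‖L‖ * M * N) ≤ L (G^[n] y - y) := by
    intro n y
    have h1 := hdrift (n / N) y
    have h2 := abs_le.1 (abs_apply_iterate_sub_le hM L (n % N) (G^[n / N * N] y))
    rw [← Function.iterate_add_apply, Nat.mod_add_div'] at h2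
    have hNn : 0 < N := by exact_mod_cast hN
    have h3 : ((n % N : ℕ) : ℝ) ≤ N := by exact_mod_cast (Nat.mod_lt n hNn).le
    have h4 : ‖L‖ * M * ((n % N : ℕ) : ℝ) ≤ ‖L‖ * M * N :=
      mul_le_mul_of_nonneg_left h3 (by positivity)
    have h5 : (n : ℝ) ≤ (n / N : ℕ) * N + N := by
      exact_mod_cast (by
        have := Nat.mod_add_div' n N
        have := (Nat.mod_lt n hNn).le
        omega : n ≤ n / N * N + N)
    have h6 : c / N * n ≤ c * (n / N : ℕ) + c := by
      have := mul_le_mul_of_nonneg_left h5 (by positivity : 0 ≤ c / N)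
      refine this.trans (le_of_eq ?_)
      field_simp
    have e : L (G^[n] y - y) = L (G^[n] y - G^[n / N * N] y) + L (G^[n / N * N] y - y) := by
      rw [← map_add, sub_add_sub_cancel]
    rw [e]
    linarith [h2.1]
  obtain ⟨x, n, hn, hlim⟩ := h0
  have hlimL := (L.continuous.tendsto 0).comp hlim
  rw [map_zero] at hlimL
  have hlim2 : Tendsto (fun i => c / N - (c + |C| + ‖L‖ * M * N) / (n i : ℝ)) atTop
      (𝓝 (c / N - 0)) :=
    tendsto_const_nhds.sub ((tendsto_natCast_atTop_atTop.comp hn).const_div_atTop _)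
  have hle : c / N - 0 ≤ 0 := by
    refine le_of_tendsto_of_tendsto hlim2 hlimL ?_
    filter_upwards [hn.eventually_ge_atTop 1] with i hi
    have h1 : (0 : ℝ) < n i := by exact_mod_cast hi
    simp only [Function.comp_apply, map_smul, smul_eq_mul]
    rw [le_inv_mul_iff₀ h1, mul_sub, mul_div_cancel₀ _ h1.ne', mul_comm]
    exact hgrow _ _
  have : 0 < c / N := by positivity
  linarith

theorem apply_eq_coords (L : ℝ × ℝ →L[ℝ] ℝ) (x : ℝ × ℝ) :
    L x = x.1 * L (1, 0) + x.2 * L (0, 1) := by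
  have e : x = x.1 • ((1, 0) : ℝ × ℝ) + x.2 • ((0, 1) : ℝ × ℝ) := by ext <;> simp
  conv_lhs => rw [e]
  rw [map_add, map_smul, map_smul, smul_eq_mul, smul_eq_mul]

/-- Determinant with a fixed vector, as a functional. -/
noncomputable def detLeft (ρ : ℝ × ℝ) : ℝ × ℝ →L[ℝ] ℝ :=
  ρ.1 • ContinuousLinearMap.snd ℝ ℝ ℝ - ρ.2 • ContinuousLinearMap.fst ℝ ℝ ℝ

theorem detLeft_apply (ρ x : ℝ × ℝ) : detLeft ρ x = ρ.1 * x.2 - ρ.2 * x.1 := by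
  simp [detLeft]

/-- Integer vectors in the kernel of a functional stay away from the kernel of a transverse one. -/
theorem exists_detLeft_lower_bound {L : ℝ × ℝ →L[ℝ] ℝ} {ρ : ℝ × ℝ} (hρ : 0 < L ρ) :
    ∃ c > 0, ∀ v : ℤ × ℤ, v ≠ 0 → L (intVec v) = 0 → c ≤ |detLeft ρ (intVec v)| := by
  have hA : 0 < |L (1, 0)| + |L (0, 1)| + 1 := by positivity
  refine ⟨L ρ / (|L (1, 0)| + |L (0, 1)| + 1), by positivity, fun v hv hLv => ?_⟩
  rw [div_le_iff₀ hA]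
  rw [apply_eq_coords] at hLv
  have hρc := apply_eq_coords L ρ
  simp only [intVec] at hLv
  have hk := abs_nonneg (detLeft ρ (intVec v))
  have e1 : (v.1 : ℝ) * L ρ = -(L (0, 1) * detLeft ρ (intVec v)) := by
    rw [hρc, detLeft_apply]; simp only [intVec]; linear_combination ρ.1 * hLv
  have e2 : (v.2 : ℝ) * L ρ = L (1, 0) * detLeft ρ (intVec v) := by
    rw [hρc, detLeft_apply]; simp only [intVec]; linear_combination ρ.2 * hLv
  have a1 := congrArg abs e1
  have a2 := congrArg abs e2
  rw [abs_neg, abs_mul, abs_mul, abs_of_pos hρ] at a1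
  rw [abs_mul, abs_mul, abs_of_pos hρ] at a2
  have hb0 := mul_nonneg (abs_nonneg (L (1, 0))) hk
  have hb1 := mul_nonneg (abs_nonneg (L (0, 1))) hk
  have hne : v.1 ≠ 0 ∨ v.2 ≠ 0 := by
    by_contra hcon
    push Not at hcon
    exact hv (Prod.ext hcon.1 hcon.2)
  rcases hne with h | h
  · have h1 : (1 : ℝ) ≤ |(v.1 : ℝ)| := by exact_mod_cast Int.one_le_abs h
    have := mul_le_mul_of_nonneg_right h1 hρ.le
    linarith
  · have h1 : (1 : ℝ) ≤ |(v.2 : ℝ)| := by exact_mod_cast Int.one_le_abs h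
    have := mul_le_mul_of_nonneg_right h1 hρ.le
    linarith

theorem floor_mul_fract_mem {Q : ℕ} (hQ : 0 < Q) (s : ℝ) :
    ⌊(Q : ℝ) * Int.fract s⌋ ∈ Finset.Ico (0 : ℤ) Q := by
  have hQ' : (0 : ℝ) < Q := by exact_mod_cast hQ
  have h1 := Int.fract_nonneg s
  have h2 := Int.fract_lt_one s
  rw [Finset.mem_Ico]
  refine ⟨Int.floor_nonneg.2 (by positivity), Int.floor_lt.2 ?_⟩
  push_cast
  nlinarith

theorem dist_add_floor_sub_lt {Q : ℕ} {ε : ℝ} (hQ : 0 < Q) (hQε : 1 / (Q : ℝ) < ε) {s t : ℝ}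
    (h : ⌊(Q : ℝ) * Int.fract s⌋ = ⌊(Q : ℝ) * Int.fract t⌋) :
    dist t (s + ((⌊t⌋ - ⌊s⌋ : ℤ) : ℝ)) < ε := by
  have hQ' : (0 : ℝ) < Q := by exact_mod_cast hQ
  have h1 := Int.abs_sub_lt_one_of_floor_eq_floor h
  rw [← mul_sub, abs_mul, abs_of_pos hQ'] at h1
  have e : t - (s + ((⌊t⌋ - ⌊s⌋ : ℤ) : ℝ)) = -(Int.fract s - Int.fract t) := by
    rw [Int.fract, Int.fract]; push_cast; ring
  rw [Real.dist_eq, e, abs_neg]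
  refine lt_trans ?_ hQε
  rw [lt_div_iff₀ hQ']; linarith

/-- The combination of recurrence, drift and absence of closed chains is contradictory when the
rotation set is contained in the line spanned by a vector on which the functional is positive. -/
theorem false_of_rotSet_subset_line {G : ℝ × ℝ → ℝ × ℝ} (hG : IsTorusLift G) {M : ℝ}
    (hM : ∀ x, ‖G x - x‖ ≤ M) {ε C : ℝ} (hε : 0 < ε) (hnc : ∀ x, ¬ ChainRel G ε x x)
    {L : ℝ × ℝ →L[ℝ] ℝ} (hC : ∀ x y, ChainRel G ε x y → -C ≤ L (y - x))
    (h0 : (0 : ℝ × ℝ) ∈ RotSet G) {ρ : ℝ × ℝ} (hρ : 0 < L ρ)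
    (hK : ∀ v ∈ RotSet G, detLeft ρ v = 0) : False := by
  obtain ⟨c, hc, hcv⟩ := exists_detLeft_lower_bound hρ
  obtain ⟨N₀, hN₀⟩ := exists_nat_one_div_lt hε
  obtain ⟨Q, hQd⟩ : ∃ Q, Q = N₀ + 1 := ⟨_, rfl⟩
  have hQ : 0 < Q := by omega
  have hQ' : (0 : ℝ) < Q := by exact_mod_cast hQ
  have hQε : 1 / (Q : ℝ) < ε := by rw [hQd]; push_cast; exact hN₀
  obtain ⟨D, hD⟩ := exists_sublinear_bound hM hK (η := c / (4 * Q ^ 2)) (by positivity)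
  obtain ⟨N, hN⟩ := exists_nat_gt (2 * (Q ^ 2 * (2 * (D + ‖detLeft ρ‖) / c + 2)))
  obtain ⟨y, hy⟩ := exists_orbit_without_positive_returns hG hM hε hC h0 N
  obtain ⟨B, hB⟩ : ∃ B, B = c / (4 * Q ^ 2) * N + D + ‖detLeft ρ‖ := ⟨_, rfl⟩
  let k : ℕ → ℝ := fun t => detLeft ρ (intVec (intFloor (G^[t] y)))
  have hk : ∀ t ≤ N, |k t - detLeft ρ y| ≤ B := by
    intro t ht
    have h1 := hD t y
    have h2 : |detLeft ρ (G^[t] y - intVec (intFloor (G^[t] y)))| ≤ ‖detLeft ρ‖ :=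
      ((detLeft ρ).le_opNorm _).trans (mul_le_of_le_one_right (norm_nonneg _)
        (norm_le_one_of_mem_unitSquare (sub_intFloor_mem _)))
    have h3 : (t : ℝ) ≤ N := by exact_mod_cast ht
    have h4 := mul_le_mul_of_nonneg_left h3 (by positivity : 0 ≤ c / (4 * (Q : ℝ) ^ 2))
    have e : k t - detLeft ρ y = detLeft ρ (G^[t] y - y)
        - detLeft ρ (G^[t] y - intVec (intFloor (G^[t] y))) := by
      simp only [k, map_sub]; ring
    rw [e, hB]
    exact (abs_sub _ _).trans (by linarith)
  let g : ℕ → ℤ × ℤ × ℤ := fun t => (⌊(Q : ℝ) * Int.fract (G^[t] y).1⌋,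
    ⌊(Q : ℝ) * Int.fract (G^[t] y).2⌋, ⌊k t / c⌋)
  let lo := ⌊(detLeft ρ y - B) / c⌋
  let hi := ⌊(detLeft ρ y + B) / c⌋
  have hmaps : ∀ t ∈ Finset.Icc 1 N,
      g t ∈ Finset.Ico (0 : ℤ) Q ×ˢ Finset.Ico (0 : ℤ) Q ×ˢ Finset.Icc lo hi := by
    intro t ht
    have h1 := abs_le.1 (hk t (Finset.mem_Icc.1 ht).2)
    refine Finset.mem_product.2 ⟨floor_mul_fract_mem hQ _, Finset.mem_product.2
      ⟨floor_mul_fract_mem hQ _, Finset.mem_Icc.2 ⟨Int.floor_le_floor ?_, Int.floor_le_floor ?_⟩⟩⟩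
    · exact div_le_div_of_nonneg_right (by linarith [h1.1]) hc.le
    · exact div_le_div_of_nonneg_right (by linarith [h1.2]) hc.le
  have hcard : (Finset.Ico (0 : ℤ) Q ×ˢ Finset.Ico (0 : ℤ) Q ×ˢ Finset.Icc lo hi).card
      < (Finset.Icc 1 N).card := by
    have hlohi : lo ≤ hi := by
      have hN1 : 1 ≤ N := by
        by_contra hN0
        obtain rfl : N = 0 := by omega
        have hD0 := hD 0 0
        have hb : 0 ≤ D := by simpa using hD0
        have : (0 : ℝ) ≤ 2 * (Q ^ 2 * (2 * (D + ‖detLeft ρ‖) / c + 2)) := by positivity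
        simp at hN
        linarith
      have hB0 : 0 ≤ B := (abs_nonneg _).trans (hk 1 hN1)
      exact Int.floor_le_floor (div_le_div_of_nonneg_right (by linarith) hc.le)
    rw [Finset.card_product, Finset.card_product, Int.card_Ico, Int.card_Icc, Nat.card_Icc,
      sub_zero, Int.toNat_natCast, Nat.add_sub_cancel]
    have h1 : (((hi + 1 - lo).toNat : ℕ) : ℝ) = hi + 1 - lo := by
      have : (((hi + 1 - lo).toNat : ℕ) : ℤ) = hi + 1 - lo := Int.toNat_of_nonneg (by omega)
      exact_mod_cast this
    have h2 : (hi : ℝ) ≤ (detLeft ρ y + B) / c := Int.floor_le _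
    have h3 : (detLeft ρ y - B) / c < lo + 1 := Int.lt_floor_add_one _
    have h4 : (hi : ℝ) + 1 - lo ≤ 2 * B / c + 2 := by
      have : (detLeft ρ y + B) / c - (detLeft ρ y - B) / c = 2 * B / c := by ring
      linarith
    have h5 : (Q : ℝ) * (Q * (2 * B / c + 2))
        = N / 2 + Q ^ 2 * (2 * (D + ‖detLeft ρ‖) / c + 2) := by
      rw [hB]; field_simp; ring
    have h6 : (Q : ℝ) * (Q * ((hi + 1 - lo).toNat : ℕ)) < N := by
      rw [h1]
      have : (Q : ℝ) * (Q * (hi + 1 - lo)) ≤ Q * (Q * (2 * B / c + 2)) := by gcongr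
      linarith
    exact_mod_cast h6
  obtain ⟨t, ht, t', ht', hne, heq⟩ := Finset.exists_ne_map_eq_of_card_lt_of_maps_to hcard hmaps
  wlog hlt : t < t' generalizing t t'
  · exact this t' ht' t ht hne.symm heq.symm (by omega)
  simp only [g, Prod.mk.injEq] at heq
  rw [Finset.mem_Icc] at ht ht'
  obtain ⟨v, hv⟩ : ∃ v, v = intFloor (G^[t'] y) - intFloor (G^[t] y) := ⟨_, rfl⟩
  have hclose : dist (G^[t'] y) (G^[t] y + intVec v) < ε := by
    rw [hv]
    exact max_lt (dist_add_floor_sub_lt hQ hQε heq.1) (dist_add_floor_sub_lt hQ hQε heq.2.1)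
  have hle := hy t t' v ht.1 hlt ht'.2 hclose
  have hret : ChainRel G ε (G^[t] y) (G^[t] y + intVec v) := by
    refine chainRel_of_dist_iterate_lt hε (k := t' - t) (by omega) ?_
    rwa [← Function.iterate_add_apply, Nat.sub_add_cancel hlt.le]
  have hv0 : v ≠ 0 := by
    intro h
    rw [h, intVec_zero, add_zero] at hret
    exact hnc _ hret
  have hmult : ∀ j : ℕ, ChainRel G ε (G^[t] y) (G^[t] y + intVec ((j + 1) • v)) := by
    intro j
    induction j with
    | zero => simpa using hret
    | succ j ih =>
      have := hret.add_intVec hG ((j + 1) • v)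
      rw [add_assoc, ← intVec_add, ← succ_nsmul'] at this
      exact Relation.TransGen.trans ih this
  have hge : 0 ≤ L (intVec v) := by
    by_contra hneg
    rw [not_le] at hneg
    obtain ⟨j, hj⟩ := exists_nat_gt (C / -L (intVec v))
    rw [div_lt_iff₀ (by linarith)] at hj
    have := hC _ _ (hmult j)
    rw [add_sub_cancel_left, intVec_nsmul, map_smul, smul_eq_mul] at this
    push_cast at this
    linarith
  have hbig := hcv v hv0 (le_antisymm hle hge)
  have hsmall := Int.abs_sub_lt_one_of_floor_eq_floor heq.2.2
  have e : k t / c - k t' / c = -(detLeft ρ (intVec v)) / c := by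
    rw [hv, intVec_sub, map_sub]; simp only [k]; ring
  rw [e, abs_div, abs_neg, abs_of_pos hc, div_lt_one hc] at hsmall
  linarith

/-- A lift of an area preserving torus homeomorphism whose rotation set lies in a segment and
contains the origin has a fixed point. -/
theorem exists_fixedPoint_of_zero_mem_rotSet (f : Torus2 ≃ₜ Torus2) (G : (ℝ × ℝ) ≃ₜ (ℝ × ℝ))
    (hG : IsTorusLift G) (hproj : ∀ x, torusProj (G x) = f (torusProj x))
    (harea : MeasurePreserving f volume volume) {a b : ℝ × ℝ} (hseg : RotSet G ⊆ segment ℝ a b)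
    (h0 : (0 : ℝ × ℝ) ∈ RotSet G) : ∃ z, G z = z := by
  by_contra! hfix
  obtain ⟨M, hM⟩ := hG.exists_displacement_bound G.continuous
  obtain ⟨δ, hδ, hδG⟩ := hG.exists_displacement_pos G.continuous hfix
  have hε : 0 < δ / 8 := by positivity
  have hnc : ∀ x, ¬ ChainRel G (δ / 8) x x := not_closed_chain hM hδ hδG
  have htrans := exists_chainRel_add_intVec f G hG hproj harea hε
  obtain ⟨α, β, hαβ, hnn⟩ := exists_linear_nonneg_of_zero_notMem
    (S := {v | ChainRel G (δ / 8) 0 (0 + intVec v)})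
    (fun u hu v hv => by
      have := ChainRel.add_intVec hG hu v
      rw [add_assoc, ← intVec_add] at this
      exact Relation.TransGen.trans hv this)
    (fun h => hnc 0 (by simpa [intVec_zero] using h))
  let L : ℝ × ℝ →L[ℝ] ℝ :=
    α • ContinuousLinearMap.fst ℝ ℝ ℝ + β • ContinuousLinearMap.snd ℝ ℝ ℝ
  have hLapp : ∀ x, L x = α * x.1 + β * x.2 := fun x => by simp [L]
  have hL : L ≠ 0 := by
    intro h
    have h1 : L (1, 0) = 0 := by rw [h]; rfl
    have h2 : L (0, 1) = 0 := by rw [h]; rfl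
    rw [hLapp] at h1 h2
    simp at h1 h2
    tauto
  obtain ⟨C, hC⟩ := exists_chain_lower_bound hG G.continuous htrans L 0
    (fun v hv => by rw [hLapp]; exact hnn v hv)
  obtain ⟨ρ, hρ, hLρ⟩ := exists_mem_rotSet_pos f G hG hproj harea hM
    (integral_displacement_pos f G hG hproj harea hM hε hL hC)
  refine false_of_rotSet_subset_line hG hM hε hnc hC h0 hLρ fun v hv => ?_
  have h0' := hseg h0
  have hρ' := hseg hρ
  have hv' := hseg hv
  rw [segment_eq_image'] at h0' hρ' hv'
  obtain ⟨s, -, hs⟩ := h0'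
  obtain ⟨t, -, rfl⟩ := hρ'
  obtain ⟨u, -, rfl⟩ := hv'
  have hs1 := congrArg Prod.fst hs
  have hs2 := congrArg Prod.snd hs
  simp only [Prod.fst_add, Prod.smul_fst, Prod.fst_sub, smul_eq_mul, Prod.fst_zero, Prod.snd_add,
    Prod.smul_snd, Prod.snd_sub, Prod.snd_zero] at hs1 hs2
  have ha1 : a.1 = - (s * (b.1 - a.1)) := by linarith
  have ha2 : a.2 = - (s * (b.2 - a.2)) := by linarith
  rw [detLeft_apply]
  simp only [Prod.fst_add, Prod.smul_fst, Prod.fst_sub, smul_eq_mul, Prod.snd_add,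
    Prod.smul_snd, Prod.snd_sub]
  generalize b.1 - a.1 = d at *
  generalize b.2 - a.2 = e at *
  rw [ha1, ha2]
  ring

theorem Homeomorph.exists_coe_eq_iterate {X : Type*} [TopologicalSpace X] (f : X ≃ₜ X) (n : ℕ) :
    ∃ g : X ≃ₜ X, (g : X → X) = f^[n] := by
  induction n with
  | zero => exact ⟨Homeomorph.refl X, rfl⟩
  | succ n ih =>
    obtain ⟨g, hg⟩ := ih
    exact ⟨f.trans g, by rw [Function.iterate_succ, ← hg]; rfl⟩

theorem iterate_iterate_sub_intVec {F G : ℝ × ℝ → ℝ × ℝ} (hF : IsTorusLift F) {q : ℕ} {m : ℤ × ℤ}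
    (hG : ∀ x, G x = F^[q] x - intVec m) (n : ℕ) (x : ℝ × ℝ) :
    G^[n] x = F^[q * n] x - (n : ℝ) • intVec m := by
  induction n with
  | zero => simp
  | succ n ih =>
    rw [Function.iterate_succ_apply', ih, hG, ← intVec_nsmul, hF.iterate_sub_intVec,
      ← Function.iterate_add_apply, intVec_nsmul, mul_add, mul_one, add_comm q]
    push_cast
    module

theorem rotSet_subset_segment_of_iterate {F G : ℝ × ℝ → ℝ × ℝ} {q : ℕ} (hq : 1 ≤ q) {w : ℝ × ℝ}
    (hG : ∀ n x, G^[n] x = F^[q * n] x - (n : ℝ) • w) {a b : ℝ × ℝ}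
    (hseg : RotSet F ⊆ segment ℝ a b) :
    RotSet G ⊆ segment ℝ ((q : ℝ) • a - w) ((q : ℝ) • b - w) := by
  have hq0 : (q : ℝ) ≠ 0 := by positivity
  rintro v ⟨x, n, hn, hv⟩
  have hmem : (q : ℝ)⁻¹ • (v + w) ∈ RotSet F := by
    refine ⟨x, fun i => q * n i, tendsto_atTop_mono (fun i => Nat.le_mul_of_pos_left _ hq) hn, ?_⟩
    refine ((hv.add_const w).const_smul (q : ℝ)⁻¹).congr' ?_
    filter_upwards [hn.eventually_ge_atTop 1] with i hi
    have hi0 : (n i : ℝ) ≠ 0 := by positivity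
    rw [hG]
    push_cast
    rw [mul_inv, mul_smul]
    congr 1
    rw [sub_right_comm, smul_sub _ _ ((n i : ℝ) • w), inv_smul_smul₀ hi0, sub_add_cancel]
  obtain ⟨s, t, hs, ht, hst, h⟩ := hseg hmem
  refine ⟨s, t, hs, ht, hst, ?_⟩
  have hv' : v = (q : ℝ) • (s • a + t • b) - (s + t) • w := by
    rw [h, smul_inv_smul₀ hq0, hst, one_smul, add_sub_cancel_right]
  rw [hv']
  module

theorem zero_mem_rotSet_of_iterate {F G : ℝ × ℝ → ℝ × ℝ} {M : ℝ} (hM : ∀ x, ‖F x - x‖ ≤ M)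
    {q : ℕ} (hq : 1 ≤ q) {ν : ℝ × ℝ}
    (hG : ∀ n x, G^[n] x = F^[q * n] x - (n : ℝ) • (q : ℝ) • ν) (hν : ν ∈ RotSet F) :
    (0 : ℝ × ℝ) ∈ RotSet G := by
  obtain ⟨x, n, hn, hlim⟩ := hν
  have hM0 : 0 ≤ M := (norm_nonneg _).trans (hM 0)
  have hm : Tendsto (fun i => n i / q) atTop atTop :=
    (Nat.tendsto_div_const_atTop (by omega)).comp hn
  refine ⟨x, fun i => n i / q, hm, ?_⟩
  rw [tendsto_zero_iff_norm_tendsto_zero]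
  have h1 : Tendsto (fun i => ‖(n i : ℝ)⁻¹ • (F^[n i] (x i) - x i) - ν‖) atTop (𝓝 0) :=
    tendsto_iff_norm_sub_tendsto_zero.1 hlim
  have h2 : Tendsto (fun i => ((n i / q : ℕ) : ℝ)⁻¹) atTop (𝓝 0) :=
    (tendsto_inv_atTop_zero.comp tendsto_natCast_atTop_atTop).comp hm
  have h3 := (h1.const_mul (2 * (q : ℝ))).add (h2.mul_const (q * M + q * ‖ν‖))
  simp only [mul_zero, zero_mul, add_zero] at h3
  refine squeeze_zero' (Eventually.of_forall fun i => norm_nonneg _) ?_ h3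
  filter_upwards [hm.eventually_ge_atTop 1] with i hi
  obtain ⟨m, hmd⟩ : ∃ m, m = n i / q := ⟨_, rfl⟩
  obtain ⟨s, hsd⟩ : ∃ s, s = n i % q := ⟨_, rfl⟩
  have hns : n i = s + q * m := by rw [hmd, hsd]; exact (Nat.mod_add_div _ _).symm
  have hsq : s < q := hsd ▸ Nat.mod_lt _ hq
  rw [← hmd] at hi ⊢
  have hm0 : (0 : ℝ) < m := by exact_mod_cast hi
  have hn0 : (n i : ℝ) ≠ 0 := by
    have : 1 ≤ q * m := Nat.mul_pos hq hi
    have : n i ≠ 0 := by omega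
    exact_mod_cast this
  have hnle : (n i : ℝ) ≤ 2 * q * m := by
    have : q * 1 ≤ q * m := Nat.mul_le_mul_left _ hi
    have : n i ≤ 2 * (q * m) := by omega
    rw [mul_assoc]; exact_mod_cast this
  have hsle : (s : ℝ) ≤ q := by exact_mod_cast hsq.le
  have hdec : G^[m] (x i) - x i
      = (n i : ℝ) • ((n i : ℝ)⁻¹ • (F^[n i] (x i) - x i) - ν)
        - (F^[s] (F^[q * m] (x i)) - F^[q * m] (x i)) + (s : ℝ) • ν := by
    rw [smul_sub, smul_inv_smul₀ hn0, ← Function.iterate_add_apply, ← hns, hG]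
    have : (n i : ℝ) = s + q * m := by exact_mod_cast hns
    rw [this]
    module
  have hb1 := norm_iterate_sub_le hM s (F^[q * m] (x i))
  have hb2 : ‖G^[m] (x i) - x i‖ ≤ (2 * q * m) * ‖(n i : ℝ)⁻¹ • (F^[n i] (x i) - x i) - ν‖
      + q * M + q * ‖ν‖ := by
    rw [hdec]
    refine (norm_add_le _ _).trans (add_le_add ((norm_sub_le _ _).trans (add_le_add ?_ ?_)) ?_)
    · rw [norm_smul, Real.norm_natCast]
      gcongr
    · exact hb1.trans (by gcongr)
    · rw [norm_smul, Real.norm_natCast]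
      gcongr
  rw [norm_smul, norm_inv, Real.norm_natCast]
  calc (m : ℝ)⁻¹ * ‖G^[m] (x i) - x i‖
      ≤ (m : ℝ)⁻¹ * ((2 * q * m) * ‖(n i : ℝ)⁻¹ • (F^[n i] (x i) - x i) - ν‖
        + q * M + q * ‖ν‖) := by gcongr
    _ = _ := by field_simp; ring

theorem torusProj_iterate {f : Torus2 → Torus2} {F : ℝ × ℝ → ℝ × ℝ}
    (hproj : ∀ x, torusProj (F x) = f (torusProj x)) (n : ℕ) (x : ℝ × ℝ) :
    torusProj (F^[n] x) = f^[n] (torusProj x) :=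
  Function.Semiconj.iterate_right (f := torusProj) hproj n x

/-- Main theorem: rational vectors in a segment rotation set of an area preserving
torus homeomorphism are realized by periodic orbits of the corresponding period. -/
theorem rational_in_segment_rotation_set_realized
    (f : Torus2 ≃ₜ Torus2) (F : (ℝ × ℝ) ≃ₜ (ℝ × ℝ))
    (hlift : IsTorusLift F)
    (hproj : ∀ x : ℝ × ℝ, torusProj (F x) = f (torusProj x))
    (harea : MeasurePreserving f volume volume)
    (a b : ℝ × ℝ) (hseg : RotSet F ⊆ segment ℝ a b)
    (p r : ℤ) (q : ℕ) (hq : 1 ≤ q)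
    (hν : ((p : ℝ) / q, (r : ℝ) / q) ∈ RotSet F) :
    ∃ z : ℝ × ℝ, (∃ n > 0, f^[n] (torusProj z) = torusProj z) ∧
      F^[q] z = z + ((p : ℝ), (r : ℝ)) := by
  obtain ⟨g, hg⟩ := f.exists_coe_eq_iterate q
  obtain ⟨H, hH⟩ := F.exists_coe_eq_iterate q
  let G : (ℝ × ℝ) ≃ₜ (ℝ × ℝ) := H.trans (Homeomorph.addRight (-intVec (p, r)))
  have hG : ∀ x, G x = F^[q] x - intVec (p, r) := fun x => by
    simp [G, hH, sub_eq_add_neg]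
  have hq0 : (q : ℝ) ≠ 0 := by positivity
  have hw : (q : ℝ) • ((p : ℝ) / q, (r : ℝ) / q) = intVec (p, r) := by
    simp [intVec, mul_div_cancel₀ _ hq0]
  have hGit := iterate_iterate_sub_intVec hlift hG
  obtain ⟨M, hM⟩ := hlift.exists_displacement_bound F.continuous
  have hGlift : IsTorusLift G := fun x m => by
    rw [hG, hG, hlift.iterate q x m, add_sub_right_comm]
  have hGproj : ∀ x, torusProj (G x) = g (torusProj x) := fun x => by
    rw [hG, sub_eq_add_neg, ← intVec_neg, torusProj_add_intVec, hg, torusProj_iterate hproj]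
  have hgarea : MeasurePreserving g volume volume := hg ▸ harea.iterate q
  obtain ⟨z, hz⟩ := exists_fixedPoint_of_zero_mem_rotSet g G hGlift hGproj hgarea
    (rotSet_subset_segment_of_iterate hq hGit hseg)
    (zero_mem_rotSet_of_iterate hM hq (hw ▸ hGit) hν)
  have hz' : F^[q] z = z + intVec (p, r) := by rw [← sub_eq_iff_eq_add, ← hG, hz]
  exact ⟨z, ⟨q, hq, by rw [← torusProj_iterate hproj, hz', torusProj_add_intVec]⟩, hz'⟩
end
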